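/- Let P be a convex lattice polygon with exactly g interior lattice points, where 7 ≤ g ≤ 12 and g ≠ 10. Then the lattice width of P is at most ⌈g/2⌉. -/

import Mathlib

/-- The canonical inclusion of the lattice `ℤ²` into the plane `ℝ²`. -/
def toReal2 (p : ℤ × ℤ) : ℝ × ℝ := ((p.1 : ℝ), (p.2 : ℝ))

/-- The lattice points of a subset of the plane. -/
def latticePoints (P : Set (ℝ × ℝ)) : Set (ℤ × ℤ) := {p | toReal2 p ∈ P}

/-- The interior lattice points of a subset of the plane. -/
def interiorLatticePoints (P : Set (ℝ × ℝ)) : Set (ℤ × ℤ) := {p | toReal2 p ∈ interior P}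

/-- The width of `P` in the direction of the integer linear functional `(u,v) ↦ au + bv`,
i.e. the difference between the sup and the inf of this functional on the lattice points
of `P`. -/
noncomputable def dirWidth (P : Set (ℝ × ℝ)) (φ : ℤ × ℤ) : ℤ :=
  sSup ((fun p : ℤ × ℤ => φ.1 * p.1 + φ.2 * p.2) '' latticePoints P) -
    sInf ((fun p : ℤ × ℤ => φ.1 * p.1 + φ.2 * p.2) '' latticePoints P)

/-- The lattice width of `P`: the minimum of the directional widths over all nonzero
integer linear functionals. -/
noncomputable def latticeWidth (P : Set (ℝ × ℝ)) : ℤ :=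
  sInf {w | ∃ φ : ℤ × ℤ, φ ≠ 0 ∧ w = dirWidth P φ}

/-- The determinant of two integer vectors. -/
def cross (u v : ℤ × ℤ) : ℤ := u.1 * v.2 - u.2 * v.1

/-- The lattice points that no real linear functional supports, i.e. the lattice points in the
topological interior of the convex hull of `L`. -/
def latticeInterior (L : Set (ℤ × ℤ)) : Set (ℤ × ℤ) :=
  {q | ∀ s t : ℝ, (s ≠ 0 ∨ t ≠ 0) →
    ∃ v ∈ L, 0 < s * ((v.1 : ℝ) - q.1) + t * ((v.2 : ℝ) - q.2)}

/-- `L` contains every lattice point that cannot be strictly separated from it. -/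
def LatticeConvex (L : Set (ℤ × ℤ)) : Prop :=
  ∀ q : ℤ × ℤ, (∀ s t : ℝ, ∃ v ∈ L, 0 ≤ s * ((v.1 : ℝ) - q.1) + t * ((v.2 : ℝ) - q.2)) → q ∈ L

/-- Every nonzero integer functional varies by at least `k` on `L`. -/
def WidthAtLeast (L : Set (ℤ × ℤ)) (k : ℤ) : Prop :=
  ∀ a b : ℤ, (a ≠ 0 ∨ b ≠ 0) → ∃ u ∈ L, ∃ v ∈ L, k ≤ a * (u.1 - v.1) + b * (u.2 - v.2)

/-- The affine map `ℤ² → ℤ²` with origin `o` and axes `u`, `w`. -/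
def chart (o u w p : ℤ × ℤ) : ℤ × ℤ :=
  (o.1 + p.1 * u.1 + p.2 * w.1, o.2 + p.1 * u.2 + p.2 * w.2)

section Basic

variable {L Q : Set (ℤ × ℤ)} {k : ℤ}

lemma WidthAtLeast.mono {j : ℤ} (h : WidthAtLeast L k) (hj : j ≤ k) : WidthAtLeast L j := by
  intro a b hab
  obtain ⟨u, hu, v, hv, h1⟩ := h a b hab
  exact ⟨u, hu, v, hv, hj.trans h1⟩

lemma latticeConvex_interior (L : Set (ℤ × ℤ)) : LatticeConvex (latticeInterior L) := by
  intro q hq s t hst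
  obtain ⟨v, hv, h1⟩ := hq s t
  obtain ⟨x, hx, h2⟩ := hv s t hst
  exact ⟨x, hx, by linarith⟩

lemma LatticeConvex.interior_subset (h : LatticeConvex L) (hne : L.Nonempty) :
    latticeInterior L ⊆ L := by
  intro q hq
  refine h q fun s t => ?_
  by_cases hst : s ≠ 0 ∨ t ≠ 0
  · obtain ⟨v, hv, h1⟩ := hq s t hst
    exact ⟨v, hv, h1.le⟩
  · push Not at hst
    obtain ⟨v, hv⟩ := hne
    exact ⟨v, hv, by simp [hst.1, hst.2]⟩

lemma LatticeConvex.combo (h : LatticeConvex L) {a b c q : ℤ × ℤ} (ha : a ∈ L) (hb : b ∈ L)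
    (hc : c ∈ L) (α β γ : ℤ) (hα : 0 ≤ α) (hβ : 0 ≤ β) (hγ : 0 ≤ γ) (hpos : 0 < α + β + γ)
    (h1 : (α + β + γ) * q.1 = α * a.1 + β * b.1 + γ * c.1)
    (h2 : (α + β + γ) * q.2 = α * a.2 + β * b.2 + γ * c.2) : q ∈ L := by
  refine h q fun s t => ?_
  by_contra! hcon
  have A := hcon a ha
  have B := hcon b hb
  have C := hcon c hc
  have h1' : ((α : ℝ) + β + γ) * q.1 = α * a.1 + β * b.1 + γ * c.1 := by exact_mod_cast h1
  have h2' : ((α : ℝ) + β + γ) * q.2 = α * a.2 + β * b.2 + γ * c.2 := by exact_mod_cast h2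
  have hα' : (0 : ℝ) ≤ α := by exact_mod_cast hα
  have hβ' : (0 : ℝ) ≤ β := by exact_mod_cast hβ
  have hγ' : (0 : ℝ) ≤ γ := by exact_mod_cast hγ
  have hpos' : (0 : ℝ) < α + β + γ := by exact_mod_cast hpos
  have key : (α : ℝ) * (s * ((a.1 : ℝ) - q.1) + t * ((a.2 : ℝ) - q.2))
      + β * (s * ((b.1 : ℝ) - q.1) + t * ((b.2 : ℝ) - q.2))
      + γ * (s * ((c.1 : ℝ) - q.1) + t * ((c.2 : ℝ) - q.2)) = 0 := by
    linear_combination -s * h1' - t * h2'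
  rcases lt_or_eq_of_le hα' with h0 | h0
  · nlinarith [mul_neg_of_pos_of_neg h0 A, mul_nonneg hβ' (neg_nonneg.2 B.le),
      mul_nonneg hγ' (neg_nonneg.2 C.le)]
  rcases lt_or_eq_of_le hβ' with h0' | h0'
  · nlinarith [mul_neg_of_pos_of_neg h0' B, mul_nonneg hα' (neg_nonneg.2 A.le),
      mul_nonneg hγ' (neg_nonneg.2 C.le)]
  have h0'' : (0 : ℝ) < γ := by linarith
  nlinarith [mul_neg_of_pos_of_neg h0'' C, mul_nonneg hβ' (neg_nonneg.2 B.le),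
      mul_nonneg hα' (neg_nonneg.2 A.le)]

lemma interior_combo {p b c q : ℤ × ℤ} (hp : p ∈ latticeInterior L) (hb : b ∈ L)
    (hc : c ∈ L) (α β γ : ℤ) (hα : 0 < α) (hβ : 0 ≤ β) (hγ : 0 ≤ γ)
    (h1 : (α + β + γ) * q.1 = α * p.1 + β * b.1 + γ * c.1)
    (h2 : (α + β + γ) * q.2 = α * p.2 + β * b.2 + γ * c.2) : q ∈ latticeInterior L := by
  intro s t hst
  obtain ⟨v, hv, hlt⟩ := hp s t hst
  by_contra! hcon
  have A := hcon v hv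
  have B := hcon b hb
  have C := hcon c hc
  have h1' : ((α : ℝ) + β + γ) * q.1 = α * p.1 + β * b.1 + γ * c.1 := by exact_mod_cast h1
  have h2' : ((α : ℝ) + β + γ) * q.2 = α * p.2 + β * b.2 + γ * c.2 := by exact_mod_cast h2
  have hα' : (0 : ℝ) < α := by exact_mod_cast hα
  have hβ' : (0 : ℝ) ≤ β := by exact_mod_cast hβ
  have hγ' : (0 : ℝ) ≤ γ := by exact_mod_cast hγ
  have key : (α : ℝ) * (s * ((p.1 : ℝ) - q.1) + t * ((p.2 : ℝ) - q.2))
      + β * (s * ((b.1 : ℝ) - q.1) + t * ((b.2 : ℝ) - q.2))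
      + γ * (s * ((c.1 : ℝ) - q.1) + t * ((c.2 : ℝ) - q.2)) = 0 := by
    linear_combination -s * h1' - t * h2'
  have P : s * ((p.1 : ℝ) - q.1) + t * ((p.2 : ℝ) - q.2) < 0 := by linarith
  nlinarith [mul_neg_of_pos_of_neg hα' P, mul_nonneg hβ' (neg_nonneg.2 B),
    mul_nonneg hγ' (neg_nonneg.2 C)]

lemma interior_of_triangle {a b c q : ℤ × ℤ} (ha : a ∈ L) (hb : b ∈ L) (hc : c ∈ L)
    (hdet : cross (b - a) (c - a) ≠ 0) (α β γ : ℤ) (hα : 0 < α) (hβ : 0 < β) (hγ : 0 < γ)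
    (h1 : (α + β + γ) * q.1 = α * a.1 + β * b.1 + γ * c.1)
    (h2 : (α + β + γ) * q.2 = α * a.2 + β * b.2 + γ * c.2) : q ∈ latticeInterior L := by
  intro s t hst
  by_contra! hcon
  have A := hcon a ha
  have B := hcon b hb
  have C := hcon c hc
  have h1' : ((α : ℝ) + β + γ) * q.1 = α * a.1 + β * b.1 + γ * c.1 := by exact_mod_cast h1
  have h2' : ((α : ℝ) + β + γ) * q.2 = α * a.2 + β * b.2 + γ * c.2 := by exact_mod_cast h2
  have hα' : (0 : ℝ) < α := by exact_mod_cast hα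
  have hβ' : (0 : ℝ) < β := by exact_mod_cast hβ
  have hγ' : (0 : ℝ) < γ := by exact_mod_cast hγ
  have key : (α : ℝ) * (s * ((a.1 : ℝ) - q.1) + t * ((a.2 : ℝ) - q.2))
      + β * (s * ((b.1 : ℝ) - q.1) + t * ((b.2 : ℝ) - q.2))
      + γ * (s * ((c.1 : ℝ) - q.1) + t * ((c.2 : ℝ) - q.2)) = 0 := by
    linear_combination -s * h1' - t * h2'
  have hA := mul_nonneg hα'.le (neg_nonneg.2 A)
  have hB := mul_nonneg hβ'.le (neg_nonneg.2 B)
  have hC := mul_nonneg hγ'.le (neg_nonneg.2 C)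
  have A0 : s * ((a.1 : ℝ) - q.1) + t * ((a.2 : ℝ) - q.2) = 0 := by
    have : (α : ℝ) * (s * ((a.1 : ℝ) - q.1) + t * ((a.2 : ℝ) - q.2)) = 0 := by linarith
    exact (mul_eq_zero.1 this).resolve_left hα'.ne'
  have B0 : s * ((b.1 : ℝ) - q.1) + t * ((b.2 : ℝ) - q.2) = 0 := by
    have : (β : ℝ) * (s * ((b.1 : ℝ) - q.1) + t * ((b.2 : ℝ) - q.2)) = 0 := by linarith
    exact (mul_eq_zero.1 this).resolve_left hβ'.ne'
  have C0 : s * ((c.1 : ℝ) - q.1) + t * ((c.2 : ℝ) - q.2) = 0 := by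
    have : (γ : ℝ) * (s * ((c.1 : ℝ) - q.1) + t * ((c.2 : ℝ) - q.2)) = 0 := by linarith
    exact (mul_eq_zero.1 this).resolve_left hγ'.ne'
  have hd : ((b.1 : ℝ) - a.1) * (c.2 - a.2) - (b.2 - a.2) * (c.1 - a.1) ≠ 0 := by
    have : ((cross (b - a) (c - a) : ℤ) : ℝ) ≠ 0 := by exact_mod_cast hdet
    simpa [cross] using this
  have hs : s * (((b.1 : ℝ) - a.1) * (c.2 - a.2) - (b.2 - a.2) * (c.1 - a.1)) = 0 := by
    linear_combination (B0 - A0) * ((c.2 : ℝ) - a.2) - (C0 - A0) * ((b.2 : ℝ) - a.2)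
  have ht : t * (((b.1 : ℝ) - a.1) * (c.2 - a.2) - (b.2 - a.2) * (c.1 - a.1)) = 0 := by
    linear_combination (C0 - A0) * ((b.1 : ℝ) - a.1) - (B0 - A0) * ((c.1 : ℝ) - a.1)
  rcases hst with h | h
  · exact h ((mul_eq_zero.1 hs).resolve_right hd)
  · exact h ((mul_eq_zero.1 ht).resolve_right hd)

end Basic

section Chart

variable {L Q : Set (ℤ × ℤ)} {k : ℤ} {o u w : ℤ × ℤ}

lemma chart_inverse (h : cross u w = 1 ∨ cross u w = -1) (q : ℤ × ℤ) :
    chart o u w (cross u w * cross (q - o) w, cross u w * cross u (q - o)) = q := by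
  have h2 : cross u w * cross u w = 1 := by rcases h with h | h <;> rw [h] <;> norm_num
  simp only [chart, cross, Prod.fst_sub, Prod.snd_sub] at *
  ext
  · simp only
    linear_combination (q.1 - o.1) * h2
  · simp only
    linear_combination (q.2 - o.2) * h2

lemma chart_bijective (h : cross u w = 1 ∨ cross u w = -1) :
    Function.Bijective (chart o u w) := by
  constructor
  · intro p q hpq
    have h2 : cross u w * cross u w = 1 := by rcases h with h | h <;> rw [h] <;> norm_num
    simp only [chart, cross, Prod.mk.injEq] at *
    obtain ⟨e1, e2⟩ := hpq
    ext
    · linear_combination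
        (u.1 * w.2 - u.2 * w.1) * (w.2 * e1 - w.1 * e2) - (p.1 - q.1) * h2
    · linear_combination
        (u.1 * w.2 - u.2 * w.1) * (u.1 * e2 - u.2 * e1) - (p.2 - q.2) * h2
  · exact fun q => ⟨_, chart_inverse h q⟩

lemma ncard_chart_preimage (h : cross u w = 1 ∨ cross u w = -1) (L : Set (ℤ × ℤ)) :
    (chart o u w ⁻¹' L).ncard = L.ncard :=
  Set.ncard_preimage_of_injective_subset_range (chart_bijective h).1
    (by simp [(chart_bijective h).2.range_eq])

lemma WidthAtLeast.chart (h : cross u w = 1 ∨ cross u w = -1) (hW : WidthAtLeast L k) :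
    WidthAtLeast (chart o u w ⁻¹' L) k := by
  intro a b hab
  have h2 : cross u w * cross u w = 1 := by rcases h with h | h <;> rw [h] <;> norm_num
  obtain ⟨p, hp, q, hq, hle⟩ := hW (cross u w * (a * w.2 - b * u.2))
    (cross u w * (b * u.1 - a * w.1)) (by
      by_contra! hcon
      have hne : cross u w ≠ 0 := by rintro h0; simp [h0] at h2
      have e1 := (mul_eq_zero.1 hcon.1).resolve_left hne
      have e2 := (mul_eq_zero.1 hcon.2).resolve_left hne
      have ha : a * cross u w = 0 := by unfold cross; linear_combination u.1 * e1 + u.2 * e2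
      have hb : b * cross u w = 0 := by unfold cross; linear_combination w.1 * e1 + w.2 * e2
      rcases hab with h' | h'
      · exact h' ((mul_eq_zero.1 ha).resolve_right hne)
      · exact h' ((mul_eq_zero.1 hb).resolve_right hne))
  obtain ⟨p, rfl⟩ := (chart_bijective (o := o) h).2 p
  obtain ⟨q, rfl⟩ := (chart_bijective (o := o) h).2 q
  refine ⟨p, hp, q, hq, hle.trans (le_of_eq ?_)⟩
  simp only [_root_.chart]
  unfold cross at *
  linear_combination (a * (p.1 - q.1) + b * (p.2 - q.2)) * h2

lemma latticeInterior_chart (h : cross u w = 1 ∨ cross u w = -1) :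
    latticeInterior (chart o u w ⁻¹' L) = chart o u w ⁻¹' latticeInterior L := by
  have h2 : cross u w * cross u w = 1 := by rcases h with h | h <;> rw [h] <;> norm_num
  have h2' : ((u.1 : ℝ) * w.2 - u.2 * w.1) * (u.1 * w.2 - u.2 * w.1) = 1 := by
    have : ((cross u w * cross u w : ℤ) : ℝ) = 1 := by exact_mod_cast h2
    simpa [cross] using this
  have hne : ((u.1 : ℝ) * w.2 - u.2 * w.1) ≠ 0 := by rintro h0; simp [h0] at h2'
  ext q
  constructor
  · intro hq s t hst
    obtain ⟨v, hv, hlt⟩ := hq (s * u.1 + t * u.2) (s * w.1 + t * w.2) (by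
      by_contra! hcon
      have hs : s * ((u.1 : ℝ) * w.2 - u.2 * w.1) = 0 := by
        linear_combination w.2 * hcon.1 - u.2 * hcon.2
      have ht : t * ((u.1 : ℝ) * w.2 - u.2 * w.1) = 0 := by
        linear_combination u.1 * hcon.2 - w.1 * hcon.1
      rcases hst with h' | h'
      · exact h' ((mul_eq_zero.1 hs).resolve_right hne)
      · exact h' ((mul_eq_zero.1 ht).resolve_right hne))
    refine ⟨_, hv, hlt.trans_le (le_of_eq ?_)⟩
    simp only [chart]
    push_cast
    ring
  · intro hq s t hst
    set d : ℝ := (u.1 : ℝ) * w.2 - u.2 * w.1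
    obtain ⟨v, hv, hlt⟩ := hq (d * (s * w.2 - t * u.2)) (d * (t * u.1 - s * w.1)) (by
      by_contra! hcon
      have e1 := (mul_eq_zero.1 hcon.1).resolve_left hne
      have e2 := (mul_eq_zero.1 hcon.2).resolve_left hne
      have hs : s * d = 0 := by simp only [d]; linear_combination u.1 * e1 + u.2 * e2
      have ht : t * d = 0 := by simp only [d]; linear_combination w.1 * e1 + w.2 * e2
      rcases hst with h' | h'
      · exact h' ((mul_eq_zero.1 hs).resolve_right hne)
      · exact h' ((mul_eq_zero.1 ht).resolve_right hne))
    obtain ⟨v, rfl⟩ := (chart_bijective (o := o) h).2 v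
    refine ⟨v, hv, hlt.trans_le (le_of_eq ?_)⟩
    simp only [chart]
    push_cast
    linear_combination (s * ((v.1 : ℝ) - q.1) + t * ((v.2 : ℝ) - q.2)) * h2'

lemma LatticeConvex.chart (hL : LatticeConvex L) :
    LatticeConvex (chart o u w ⁻¹' L) := by
  intro q hq
  refine hL _ fun s t => ?_
  obtain ⟨v, hv, hle⟩ := hq (s * u.1 + t * u.2) (s * w.1 + t * w.2)
  refine ⟨_, hv, hle.trans (le_of_eq ?_)⟩
  simp only [_root_.chart]
  push_cast
  ring

end Chart

section Edge

variable {L Q : Set (ℤ × ℤ)} {k : ℤ} {a b c v : ℤ × ℤ}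

lemma exists_height_one_vector {e z : ℤ × ℤ} (he : IsCoprime e.1 e.2) (hd : 0 < cross e z) :
    ∃ p : ℤ × ℤ, ∃ α β : ℤ, 0 ≤ α ∧ 0 ≤ β ∧ α + β = cross e z - 1 ∧ cross e p = 1 ∧
      cross e z * p.1 = z.1 + β * e.1 ∧ cross e z * p.2 = z.2 + β * e.2 := by
  obtain ⟨r, s, hrs⟩ := he
  set d := cross e z with hdd
  set x : ℤ := z.1 * r + z.2 * s
  have hβ := Int.emod_nonneg (-x) hd.ne'
  have hβ' := Int.emod_lt_of_pos (-x) hd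
  set β := (-x) % d
  set m := -((-x) / d)
  have hm : d * m = x + β := by
    have := Int.emod_add_mul_ediv (-x) d
    simp only [m, β]; linarith
  refine ⟨(m * e.1 - s, m * e.2 + r), d - 1 - β, β, by linarith, hβ, by ring, ?_, ?_, ?_⟩
  · simp only [cross]; linear_combination hrs
  · simp only [cross] at hdd ⊢
    linear_combination e.1 * hm - s * hdd + z.1 * hrs
  · simp only [cross] at hdd ⊢
    linear_combination e.2 * hm + r * hdd + z.2 * hrs

lemma cross_reverse (a b v : ℤ × ℤ) : cross (a - b) (v - b) = -cross (b - a) (v - a) := by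
  simp only [cross, Prod.fst_sub, Prod.snd_sub]; ring

lemma exists_interior_height_one (ha : a ∈ latticeInterior L) (hb : b ∈ latticeInterior L)
    (hv : v ∈ L) (hab : IsCoprime (b - a).1 (b - a).2) (hd : 2 ≤ cross (b - a) (v - a))
    (hL : LatticeConvex L) :
    ∃ p ∈ latticeInterior L, cross (b - a) (p - a) = 1 := by
  obtain ⟨p, α, β, hα, hβ, hsum, hp, h1, h2⟩ := exists_height_one_vector hab (by linarith)
  have haL := hL.interior_subset ⟨v, hv⟩ ha
  have hbL := hL.interior_subset ⟨v, hv⟩ hb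
  simp only [Prod.fst_sub, Prod.snd_sub] at h1 h2
  refine ⟨a + p, ?_, by simpa using hp⟩
  have hs : α + β + 1 = cross (b - a) (v - a) := by linarith
  rcases hα.lt_or_eq with h | h
  · refine interior_combo ha hbL hv α β 1 h hβ (by norm_num) ?_ ?_
    · rw [hs, Prod.fst_add]; linear_combination h1 - a.1 * hs
    · rw [hs, Prod.snd_add]; linear_combination h2 - a.2 * hs
  · have hs' : β + 0 + 1 = cross (b - a) (v - a) := by linarith
    refine interior_combo hb haL hv β 0 1 (by linarith) le_rfl (by norm_num) ?_ ?_
    · rw [hs', Prod.fst_add]; linear_combination h1 - a.1 * hs'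
    · rw [hs', Prod.snd_add]; linear_combination h2 - a.2 * hs'

lemma LatticeConvex.exists_height_one (hQ : LatticeConvex Q) (ha : a ∈ Q) (hb : b ∈ Q)
    (hv : v ∈ Q) (hab : IsCoprime (b - a).1 (b - a).2) (hd : 0 < cross (b - a) (v - a)) :
    ∃ p ∈ Q, cross (b - a) (p - a) = 1 := by
  obtain ⟨p, α, β, hα, hβ, hsum, hp, h1, h2⟩ := exists_height_one_vector hab hd
  simp only [Prod.fst_sub, Prod.snd_sub] at h1 h2
  refine ⟨a + p, ?_, by simpa using hp⟩
  have hs : α + β + 1 = cross (b - a) (v - a) := by linarith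
  refine hQ.combo ha hb hv α β 1 hα hβ (by norm_num) (by linarith) ?_ ?_
  · rw [hs, Prod.fst_add]; linear_combination h1 - a.1 * hs
  · rw [hs, Prod.snd_add]; linear_combination h2 - a.2 * hs

/-- `b - a` is a primitive boundary step of `Q`, with `Q` on its left. -/
structure Adj (Q : Set (ℤ × ℤ)) (a b : ℤ × ℤ) : Prop where
  left_mem : a ∈ Q
  right_mem : b ∈ Q
  coprime : IsCoprime (b - a).1 (b - a).2
  nonneg : ∀ q ∈ Q, 0 ≤ cross (b - a) (q - a)

lemma Adj.ne_zero (h : Adj Q a b) : (b - a).1 ≠ 0 ∨ (b - a).2 ≠ 0 := by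
  by_contra! hcon
  have := h.coprime
  rw [hcon.1, hcon.2] at this
  exact not_isCoprime_zero_zero this

lemma Adj.neg_one_le (hL : LatticeConvex L) (h : Adj (latticeInterior L) a b) (hv : v ∈ L) :
    -1 ≤ cross (b - a) (v - a) := by
  by_contra! hcon
  have hc : IsCoprime (a - b).1 (a - b).2 := by
    have := h.coprime.neg_neg
    simpa using this
  obtain ⟨p, hp, hp1⟩ := exists_interior_height_one h.right_mem h.left_mem hv hc
    (by rw [cross_reverse]; linarith) hL
  have := h.nonneg p hp
  rw [cross_reverse] at hp1
  linarith

lemma notMem_interior_of_cross_nonneg {e p : ℤ × ℤ} (he : e.1 ≠ 0 ∨ e.2 ≠ 0)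
    (h : ∀ q ∈ Q, 0 ≤ cross e (q - p)) : p ∉ latticeInterior Q := by
  intro hp
  obtain ⟨v, hv, hlt⟩ := hp (e.2 : ℝ) (-e.1 : ℝ) (by
    rcases he with h' | h'
    · exact Or.inr (neg_ne_zero.2 (Int.cast_ne_zero.2 h'))
    · exact Or.inl (Int.cast_ne_zero.2 h'))
  have h2 : (0 : ℝ) ≤ ((cross e (v - p) : ℤ) : ℝ) := by exact_mod_cast h v hv
  simp only [cross, Prod.fst_sub, Prod.snd_sub] at h2
  push_cast at h2
  linarith

lemma Adj.right_notMem_interior (h : Adj Q a b) : b ∉ latticeInterior Q := by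
  refine notMem_interior_of_cross_nonneg h.ne_zero fun q hq => ?_
  have := h.nonneg q hq
  simp only [cross, Prod.fst_sub, Prod.snd_sub] at *
  linarith

lemma WidthAtLeast.exists_cross (hW : WidthAtLeast Q k) {e : ℤ × ℤ} (he : e.1 ≠ 0 ∨ e.2 ≠ 0) :
    ∃ u ∈ Q, ∃ v ∈ Q, k ≤ cross e (u - v) := by
  obtain ⟨u, hu, v, hv, h⟩ := hW (-e.2) e.1 (by
    rcases he with h | h
    · exact Or.inr h
    · exact Or.inl (neg_ne_zero.2 h))
  refine ⟨u, hu, v, hv, h.trans (le_of_eq ?_)⟩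
  simp only [cross, Prod.fst_sub, Prod.snd_sub]; ring

lemma Adj.exists_height (h : Adj Q a b) (hW : WidthAtLeast Q k) :
    ∃ v ∈ Q, k ≤ cross (b - a) (v - a) := by
  obtain ⟨u, hu, v, hv, h1⟩ := hW.exists_cross h.ne_zero
  refine ⟨u, hu, ?_⟩
  have := h.nonneg v hv
  simp only [cross, Prod.fst_sub, Prod.snd_sub] at *
  linarith

lemma Adj.not_symm (hW : WidthAtLeast Q 1) (h : Adj Q a b) : ¬ Adj Q b a := by
  intro h'
  obtain ⟨v, hv, h1⟩ := h.exists_height hW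
  have := h'.nonneg v hv
  rw [cross_reverse] at this
  linarith

lemma eq_or_eq_neg_of_cross_eq_zero {e f : ℤ × ℤ} (he : IsCoprime e.1 e.2)
    (hf : IsCoprime f.1 f.2) (h : cross e f = 0) : f = e ∨ f = -e := by
  obtain ⟨r, s, hrs⟩ := he
  obtain ⟨r', s', hrs'⟩ := hf
  simp only [cross] at h
  have h1 : f.1 = (r * f.1 + s * f.2) * e.1 := by linear_combination -f.1 * hrs - s * h
  have h2 : f.2 = (r * f.1 + s * f.2) * e.2 := by linear_combination -f.2 * hrs + r * h
  have hu : IsUnit (r * f.1 + s * f.2) := by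
    refine IsUnit.of_mul_eq_one (r' * e.1 + s' * e.2) ?_
    linear_combination hrs' - r' * h1 - s' * h2
  rcases Int.isUnit_iff.1 hu with h' | h'
  · left; rw [h'] at h1 h2; ext <;> linarith
  · right; rw [h'] at h1 h2; ext <;> simp <;> linarith

lemma exists_isCoprime_mul {z : ℤ × ℤ} (hz : z ≠ 0) :
    ∃ e : ℤ × ℤ, ∃ g : ℤ, 0 < g ∧ IsCoprime e.1 e.2 ∧ z.1 = g * e.1 ∧ z.2 = g * e.2 := by
  have hg : 0 < Int.gcd z.1 z.2 := by
    rw [Nat.pos_iff_ne_zero]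
    intro h
    rw [Int.gcd_eq_zero_iff] at h
    exact hz (Prod.ext h.1 h.2)
  obtain ⟨m, n, hmn, h1, h2⟩ := Int.exists_gcd_one hg
  exact ⟨(m, n), Int.gcd z.1 z.2, by exact_mod_cast hg, Int.isCoprime_iff_gcd_eq_one.2 hmn,
    by linarith, by linarith⟩

lemma LatticeConvex.exists_adj (hQ : LatticeConvex Q) (hfin : Q.Finite) (hW : WidthAtLeast Q 1)
    (ha : a ∈ Q) (haI : a ∉ latticeInterior Q) : ∃ b, Adj Q a b := by
  suffices h : ∃ v ∈ Q, v ≠ a ∧ ∀ q ∈ Q, 0 ≤ cross (v - a) (q - a) by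
    obtain ⟨v, hv, hva, h⟩ := h
    obtain ⟨e, g, hg, he, h1, h2⟩ := exists_isCoprime_mul (sub_ne_zero.2 hva)
    simp only [Prod.fst_sub, Prod.snd_sub] at h1 h2
    refine ⟨a + e, ha, ?_, by simpa using he, fun q hq => ?_⟩
    · refine hQ.combo ha ha hv (g - 1) 0 1 (by linarith) le_rfl (by norm_num) (by linarith) ?_ ?_
      · rw [Prod.fst_add]; linear_combination -h1
      · rw [Prod.snd_add]; linear_combination -h2
    · have := h q hq
      have h3 : cross (v - a) (q - a) = g * cross (a + e - a) (q - a) := by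
        simp only [cross, Prod.fst_sub, Prod.snd_sub, h1, h2, add_sub_cancel_left]; ring
      rw [h3] at this
      exact nonneg_of_mul_nonneg_right this hg
  have haI' : ∃ s t : ℝ, (s ≠ 0 ∨ t ≠ 0) ∧
      ∀ v ∈ Q, s * ((v.1 : ℝ) - a.1) + t * ((v.2 : ℝ) - a.2) ≤ 0 := by
    by_contra! hcon
    exact haI hcon
  obtain ⟨s, t, hst, hneg⟩ := haI'
  have hn : 0 < s * s + t * t := by
    rcases hst with h | h
    · nlinarith [mul_self_pos.2 h, mul_self_nonneg t]
    · nlinarith [mul_self_pos.2 h, mul_self_nonneg s]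
  -- the component along the supporting line and the distance from it
  set τ : ℤ × ℤ → ℝ := fun v => -t * ((v.1 : ℝ) - a.1) + s * ((v.2 : ℝ) - a.2)
  set δ : ℤ × ℤ → ℝ := fun v => -(s * ((v.1 : ℝ) - a.1) + t * ((v.2 : ℝ) - a.2))
  have hδ : ∀ v ∈ Q, 0 ≤ δ v := fun v hv => by simpa [δ] using neg_nonneg.2 (hneg v hv)
  have key : ∀ v q, (s * s + t * t) * ((cross (v - a) (q - a) : ℤ) : ℝ)
      = τ v * δ q - δ v * τ q := by
    intro v q
    simp only [cross, Prod.fst_sub, Prod.snd_sub, τ, δ]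
    push_cast
    ring
  have crit : ∀ v q, 0 ≤ τ v * δ q - δ v * τ q → 0 ≤ cross (v - a) (q - a) := by
    intro v q h
    rw [← key] at h
    exact_mod_cast nonneg_of_mul_nonneg_right h hn
  by_cases hline : ∃ v ∈ Q, δ v = 0 ∧ 0 < τ v
  · obtain ⟨v, hv, h0, h1⟩ := hline
    refine ⟨v, hv, ?_, fun q hq => crit _ _ ?_⟩
    · rintro rfl; simp [τ] at h1
    · rw [h0]; nlinarith [hδ q hq]
  push Not at hline
  set T := {v ∈ Q | 0 < δ v}
  have hT : T.Nonempty := by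
    obtain ⟨u, hu, v, hv, huv⟩ := hW 1 0 (by norm_num)
    by_contra! hcon
    have hz : ∀ v ∈ Q, δ v = 0 := by
      intro v hv
      by_contra h
      exact (Set.eq_empty_iff_forall_notMem.1 hcon) v ⟨hv, (hδ v hv).lt_of_ne' h⟩
    have hcol : ∀ u ∈ Q, ∀ v ∈ Q, cross (u - a) (v - a) = 0 := by
      intro u hu v hv
      have := key u v
      rw [hz u hu, hz v hv] at this
      have h2 : ((cross (u - a) (v - a) : ℤ) : ℝ) = 0 := by
        rcases mul_eq_zero.1 (this.trans (by ring)) with h | h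
        · exact absurd h hn.ne'
        · exact h
      exact_mod_cast h2
    have hex : ∃ z ∈ Q, z ≠ a := by
      by_contra! h
      rw [h u hu, h v hv] at huv
      simp at huv
    obtain ⟨z, hz, hza⟩ := hex
    have hz0 : (z - a).1 ≠ 0 ∨ (z - a).2 ≠ 0 := by
      by_contra! h
      exact hza (sub_eq_zero.1 (Prod.ext h.1 h.2))
    obtain ⟨p, hp, q, hq, h⟩ := hW.exists_cross hz0
    have e1 := hcol z hz p hp
    have e2 := hcol z hz q hq
    simp only [cross, Prod.fst_sub, Prod.snd_sub] at *
    linarith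
  obtain ⟨v, ⟨hv, hv0⟩, hmax⟩ := (hfin.subset (Set.sep_subset _ _)).exists_maximalFor
    (fun v => τ v / δ v) T hT
  refine ⟨v, hv, ?_, fun q hq => crit _ _ ?_⟩
  · rintro rfl; simp [δ] at hv0
  · rcases (hδ q hq).lt_or_eq with h | h
    · have h1 : τ q / δ q ≤ τ v / δ v := by
        by_contra! hlt
        exact absurd (hmax ⟨hq, h⟩ hlt.le) (not_le.2 hlt)
      rw [div_le_div_iff₀ h hv0] at h1
      linarith
    · have := hline q hq h.symm
      rw [← h]
      nlinarith

end Edge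

section BoundaryCycle

variable {L Q : Set (ℤ × ℤ)} {a b c d z : ℤ × ℤ}

lemma Adj.eq_of_cross_eq_zero (hW : WidthAtLeast Q 1) (h : Adj Q a b) (h' : Adj Q b c)
    (h0 : cross (b - a) (c - b) = 0) : b - a = c - b := by
  rcases eq_or_eq_neg_of_cross_eq_zero h.coprime h'.coprime h0 with he | he
  · exact he.symm
  · have : c = a := by simpa using he
    exact absurd (this ▸ h') (h.not_symm hW)

lemma Adj.cross_nonneg (h : Adj Q a b) (h' : Adj Q b c) : 0 ≤ cross (b - a) (c - b) := by
  have := h.nonneg c h'.right_mem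
  simp only [cross, Prod.fst_sub, Prod.snd_sub] at *
  linarith

lemma Adj.exists_corner (hL : LatticeConvex L) (hW : WidthAtLeast (latticeInterior L) 1)
    (h : Adj (latticeInterior L) a b) (h' : Adj (latticeInterior L) b c) :
    ∃ f, cross (b - a) f = 1 ∧ cross (c - b) f = 1 := by
  have hD := h.cross_nonneg h'
  have hI := h.right_mem
  have hcross : ∀ v ∈ L, -1 ≤ cross (b - a) (v - b) := fun v hv => by
    have := h.neg_one_le hL hv
    simp only [cross, Prod.fst_sub, Prod.snd_sub] at *
    linarith
  have hcross' : ∀ v ∈ L, -1 ≤ cross (c - b) (v - b) := fun v hv => h'.neg_one_le hL hv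
  have heq := h.eq_of_cross_eq_zero hW h'
  obtain ⟨r, s, hrs⟩ := h.coprime
  generalize b - a = e₁ at *
  generalize c - b = e₂ at *
  rcases hD.lt_or_eq with hD | hD
  swap
  · rw [← heq hD.symm]
    refine ⟨(-s, r), ?_⟩
    simp only [cross]
    constructor <;> linear_combination hrs
  set D := cross e₁ e₂ with hDdef
  set x := e₂.1 * r + e₂.2 * s
  have hr0 := Int.emod_nonneg (x - 1) hD.ne'
  have hr1 := Int.emod_lt_of_pos (x - 1) hD
  have hdm := Int.emod_add_mul_ediv (x - 1) D
  set t := (x - 1) % D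
  set j := (x - 1) / D
  set g : ℤ × ℤ := (j * e₁.1 - s, j * e₁.2 + r)
  have hg : cross e₁ g = 1 := by simp only [g, cross]; linear_combination hrs
  have hg2 : cross e₂ g = 1 + t := by
    simp only [g, cross] at *
    linear_combination -hdm + j * hDdef
  rcases hr0.lt_or_eq with ht | ht
  swap
  · exact ⟨g, hg, by rw [hg2, ← ht]; norm_num⟩
  exfalso
  refine notMem_interior_of_cross_nonneg (e := e₁ + g) ?_ ?_ hI
  · by_contra! hcon
    simp only [cross, Prod.fst_add, Prod.snd_add] at hg hcon
    have : (1 : ℤ) = 0 := by linear_combination -hg + e₁.1 * hcon.2 - e₁.2 * hcon.1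
    norm_num at this
  · intro v hv
    have hY := hcross v hv
    have hY' := hcross' v hv
    have hX : cross e₂ (v - b) = (1 + t) * cross e₁ (v - b) + D * cross g (v - b) := by
      rw [← hg2]
      simp only [cross] at *
      linear_combination (-e₂.1 * (v - b).2 + e₂.2 * (v - b).1) * hg
        - (g.1 * (v - b).2 - g.2 * (v - b).1) * hDdef
    rw [hX] at hY'
    have hsum : cross (e₁ + g) (v - b) = cross e₁ (v - b) + cross g (v - b) := by
      simp only [cross, Prod.fst_add, Prod.snd_add]; ring
    rw [hsum]
    generalize cross e₁ (v - b) = Y at *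
    generalize cross g (v - b) = X at *
    by_contra! hlt
    have h1 : D * X ≤ D * (-1 - Y) := mul_le_mul_of_nonneg_left (by linarith) hD.le
    rcases le_or_gt 0 Y with h2 | h2
    · nlinarith
    · have : Y = -1 := by linarith
      subst this
      linarith

/-- Four consecutive boundary steps `e₀, e₁, e₂, e₃`, of which the middle two have height one
over `f`, where the functional `cross · f` does not confine the polygon to a thin strip. -/
structure Turn (e₀ e₁ e₂ e₃ f : ℤ × ℤ) : Prop where
  nonneg : 0 ≤ cross e₁ e₂
  eq : cross e₁ e₂ = 0 → e₁ = e₂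
  left : cross e₁ f = 1
  right : cross e₂ f = 1
  wide : 1 ≤ cross e₀ f ∨ 1 ≤ cross e₃ f

lemma cross_mul_cross (u v w z : ℤ × ℤ) :
    cross u v * cross w z = cross u z * cross w v - cross v z * cross w u := by
  simp only [cross]; ring

lemma cross_swap (u v : ℤ × ℤ) : cross v u = -cross u v := by
  simp only [cross]; ring

lemma Adj.exists_turn (hL : LatticeConvex L) (hW : WidthAtLeast (latticeInterior L) 3)
    (h₀ : Adj (latticeInterior L) z a) (h₁ : Adj (latticeInterior L) a b)
    (h₂ : Adj (latticeInterior L) b c) (h₃ : Adj (latticeInterior L) c d) :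
    ∃ f, Turn (a - z) (b - a) (c - b) (d - c) f := by
  have hW1 := hW.mono (show (1 : ℤ) ≤ 3 by norm_num)
  obtain ⟨f, hf1, hf2⟩ := h₁.exists_corner hL hW1 h₂
  refine ⟨f, h₁.cross_nonneg h₂, h₁.eq_of_cross_eq_zero hW1 h₂, hf1, hf2, ?_⟩
  by_contra! hcon
  have hD0 : 0 < cross (a - z) (b - a) := by
    refine (h₀.cross_nonneg h₁).lt_of_ne' fun h => ?_
    rw [h₀.eq_of_cross_eq_zero hW1 h₁ h] at hcon
    linarith [hcon.1]
  have hD3 : 0 < cross (c - b) (d - c) := by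
    refine (h₂.cross_nonneg h₃).lt_of_ne' fun h => ?_
    rw [← h₂.eq_of_cross_eq_zero hW1 h₃ h] at hcon
    linarith [hcon.2]
  have low : ∀ q ∈ latticeInterior L, 0 ≤ cross (q - a) f := by
    intro q hq
    have q1 := h₁.nonneg q hq
    have q0 : 0 ≤ cross (a - z) (q - a) := by
      have := h₀.nonneg q hq
      simp only [cross, Prod.fst_sub, Prod.snd_sub] at *
      linarith
    have key : cross (a - z) (b - a) * cross (q - a) f
        = cross (a - z) (q - a) * cross (b - a) f - cross (b - a) (q - a) * cross (a - z) f := by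
      simp only [cross]; ring
    refine nonneg_of_mul_nonneg_right (b := cross (q - a) f) ?_ hD0
    rw [key, hf1]
    nlinarith [hcon.1]
  have high : ∀ q ∈ latticeInterior L, cross (q - c) f ≤ 0 := by
    intro q hq
    have q3 := h₃.nonneg q hq
    have q2 : 0 ≤ cross (c - b) (q - c) := by
      have := h₂.nonneg q hq
      simp only [cross, Prod.fst_sub, Prod.snd_sub] at *
      linarith
    have key : cross (c - b) (d - c) * cross (q - c) f
        = cross (c - b) (q - c) * cross (d - c) f - cross (d - c) (q - c) * cross (c - b) f := by
      simp only [cross]; ring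
    by_contra! hlt
    have := mul_pos hD3 hlt
    rw [key, hf2] at this
    nlinarith [hcon.2]
  obtain ⟨u, hu, v, hv, huv⟩ := hW.exists_cross (e := f) (by
    by_contra! h0
    simp [cross, h0.1, h0.2] at hf1)
  have h1 := low u hu
  have h2 := high v hv
  simp only [cross, Prod.fst_sub, Prod.snd_sub] at *
  linarith

lemma Turn.wide_cross {e₀ e₁ e₂ e₃ f : ℤ × ℤ} (h : Turn e₀ e₁ e₂ e₃ f) :
    cross e₁ e₂ ≤ cross e₀ e₂ - cross e₀ e₁ ∨ cross e₁ e₂ ≤ cross e₁ e₃ - cross e₂ e₃ := by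
  have key : ∀ w, cross e₁ e₂ * cross w f = cross w e₂ - cross w e₁ := by
    intro w
    rw [cross_mul_cross, h.left, h.right]; ring
  have h0 := h.nonneg
  rcases h.wide with h' | h'
  · left
    have := key e₀
    nlinarith
  · right
    have := key e₃
    rw [cross_swap e₂ e₃, cross_swap e₁ e₃] at this
    nlinarith

lemma cross_add_left (u v w : ℤ × ℤ) : cross (u + v) w = cross u w + cross v w := by
  simp only [cross, Prod.fst_add, Prod.snd_add]; ring

lemma cross_add_right (u v w : ℤ × ℤ) : cross w (u + v) = cross w u + cross w v := by
  simp only [cross, Prod.fst_add, Prod.snd_add]; ring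

@[simp] lemma cross_zero_left (w : ℤ × ℤ) : cross 0 w = 0 := by simp [cross]

@[simp] lemma cross_zero_right (w : ℤ × ℤ) : cross w 0 = 0 := by simp [cross]

@[simp] lemma cross_same (w : ℤ × ℤ) : cross w w = 0 := by simp only [cross]; ring

lemma not_turn_three {e₁ e₂ e₃ f : ℤ × ℤ} (h : Turn e₃ e₁ e₂ e₃ f)
    (hsum : e₁ + e₂ + e₃ = 0) : False := by
  have := congrArg (cross · f) hsum
  simp only [cross_add_left, cross_zero_left, h.left, h.right] at this
  rcases h.wide with h' | h' <;> linarith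

lemma not_turn_four_of_eq {e₁ e₃ e₄ f₃ : ℤ × ℤ} (h : Turn e₁ e₃ e₄ e₁ f₃)
    (hsum : e₁ + e₁ + e₃ + e₄ = 0) : False := by
  have := congrArg (cross · f₃) hsum
  simp only [cross_add_left, cross_zero_left, h.left, h.right] at this
  rcases h.wide with h' | h' <;> linarith

lemma not_turn_four {e₁ e₂ e₃ e₄ f₁ f₂ f₃ f₄ : ℤ × ℤ} (h₁ : Turn e₄ e₁ e₂ e₃ f₁)
    (h₂ : Turn e₁ e₂ e₃ e₄ f₂) (h₃ : Turn e₂ e₃ e₄ e₁ f₃) (h₄ : Turn e₃ e₄ e₁ e₂ f₄)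
    (hsum : e₁ + e₂ + e₃ + e₄ = 0) : False := by
  rcases h₁.nonneg.lt_or_eq with d₁ | d₁
  swap
  · obtain rfl := h₁.eq d₁.symm
    exact not_turn_four_of_eq h₃ hsum
  rcases h₂.nonneg.lt_or_eq with d₂ | d₂
  swap
  · obtain rfl := h₂.eq d₂.symm
    exact not_turn_four_of_eq h₄ (by rw [← hsum]; abel)
  rcases h₃.nonneg.lt_or_eq with d₃ | d₃
  swap
  · obtain rfl := h₃.eq d₃.symm
    exact not_turn_four_of_eq h₁ (by rw [← hsum]; abel)
  rcases h₄.nonneg.lt_or_eq with d₄ | d₄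
  swap
  · obtain rfl := h₄.eq d₄.symm
    exact not_turn_four_of_eq h₂ (by rw [← hsum]; abel)
  have w₁ := h₁.wide_cross
  have w₂ := h₂.wide_cross
  have w₃ := h₃.wide_cross
  have w₄ := h₄.wide_cross
  have s₁ := congrArg (cross e₁ ·) hsum
  have s₂ := congrArg (cross e₂ ·) hsum
  have s₃ := congrArg (cross e₃ ·) hsum
  simp only [cross_add_right, cross_zero_right, cross_same] at s₁ s₂ s₃
  rw [cross_swap e₁ e₂] at s₂
  rw [cross_swap e₁ e₃, cross_swap e₂ e₃] at s₃
  simp only [cross_swap e₁ e₄, cross_swap e₂ e₄, cross_swap e₁ e₃] at *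
  omega

lemma not_turn_five_of_cover {e₁ e₂ e₃ e₅ : ℤ × ℤ} (d₁ : 0 < cross e₁ e₂)
    (d₂ : 0 < cross e₂ e₃) (d₅ : 0 < cross e₅ e₁) :
    ¬ (0 < cross e₃ e₅ ∧ cross e₅ e₁ + cross e₁ e₂ ≤ cross e₅ e₂ ∧
      cross e₁ e₂ + cross e₂ e₃ ≤ cross e₁ e₃) := by
  rintro ⟨d₃₅, n₁, n₂⟩
  have key : cross e₅ e₁ * cross e₂ e₃ = cross e₅ e₂ * cross e₁ e₃ + cross e₃ e₅ * cross e₁ e₂ := by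
    simp only [cross]; ring
  nlinarith [mul_pos d₃₅ d₁, mul_pos d₅ d₁, mul_pos d₁ d₂, mul_pos d₁ d₁,
    mul_le_mul n₁ n₂ (by linarith) (by linarith)]

lemma not_turn_five_of_eq {e g₂ g₃ g₄ f₂ f₃ f₄ f₅ : ℤ × ℤ}
    (h₂ : Turn e e g₂ g₃ f₂) (h₃ : Turn e g₂ g₃ g₄ f₃) (h₄ : Turn g₂ g₃ g₄ e f₄)
    (h₅ : Turn g₃ g₄ e e f₅) (hsum : e + e + g₂ + g₃ + g₄ = 0) : False := by
  have s₂ := congrArg (cross · f₂) hsum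
  have s₃ := congrArg (cross · f₃) hsum
  have s₄ := congrArg (cross · f₄) hsum
  have s₅ := congrArg (cross · f₅) hsum
  simp only [cross_add_left, cross_zero_left, h₂.left, h₃.left, h₄.left, h₅.left, h₂.right,
    h₃.right, h₄.right, h₅.right] at s₂ s₃ s₄ s₅
  rcases h₂.nonneg.lt_or_eq with d₂ | d₂
  swap
  · obtain rfl := h₂.eq d₂.symm
    omega
  rcases h₃.nonneg.lt_or_eq with d₃ | d₃
  swap
  · obtain rfl := h₃.eq d₃.symm
    have := h₃.left
    have := h₄.left
    omega
  rcases h₄.nonneg.lt_or_eq with d₄ | d₄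
  swap
  · obtain rfl := h₄.eq d₄.symm
    have := h₃.right
    omega
  rcases h₅.nonneg.lt_or_eq with d₅ | d₅
  swap
  · obtain rfl := h₅.eq d₅.symm
    omega
  have p₂ := congrArg (cross g₂ ·) hsum
  have p₃ := congrArg (cross g₃ ·) hsum
  have p₄ := congrArg (cross g₄ ·) hsum
  simp only [cross_add_right, cross_zero_right, cross_same] at p₂ p₃ p₄
  have k₂ := cross_mul_cross e g₂ g₃ f₂
  have k₃ := cross_mul_cross g₂ g₃ g₄ f₃
  have k₄ := cross_mul_cross g₃ g₄ g₂ f₄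
  have k₅ := cross_mul_cross g₄ e g₃ f₅
  have w₃ := h₃.wide
  have w₄ := h₄.wide
  rw [h₂.left, h₂.right] at k₂
  rw [h₃.left, h₃.right] at k₃
  rw [h₄.left, h₄.right] at k₄
  rw [h₅.left, h₅.right] at k₅
  rw [cross_swap e g₂, cross_swap g₂ g₃, cross_swap g₂ g₄, cross_swap g₃ g₄,
    cross_swap e g₃] at *
  generalize cross g₃ f₂ = u at *
  generalize cross g₃ f₅ = u' at *
  generalize cross g₄ f₃ = s at *
  generalize cross g₂ f₄ = r at *
  generalize cross e f₃ = s' at *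
  generalize cross e f₄ = r' at *
  have hs : s ≤ -4 ∨ 2 ≤ s := by omega
  have hr : r ≤ -4 ∨ 2 ≤ r := by omega
  generalize cross e g₂ = P at *
  generalize cross g₄ e = M at *
  generalize cross e g₃ = X at *
  generalize cross g₂ g₃ = A at *
  generalize cross g₃ g₄ = B at *
  generalize cross g₂ g₄ = C at *
  rcases hs with hs | hs
  · have h1 : 3 * A < B := by nlinarith
    rcases hr with hr | hr <;> nlinarith
  rcases hr with hr | hr
  · nlinarith
  have hu : u = 0 := by
    have h1 : u < 1 := by
      by_contra! h
      nlinarith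
    have h2 : -1 < u := by
      by_contra! h
      nlinarith
    omega
  have hu' : u' = 0 := by
    have h1 : u' < 1 := by
      by_contra! h
      nlinarith
    have h2 : -1 < u' := by
      by_contra! h
      nlinarith
    omega
  subst hu hu'
  linarith

lemma not_turn_five {e₁ e₂ e₃ e₄ e₅ f₁ f₂ f₃ f₄ f₅ : ℤ × ℤ} (h₁ : Turn e₅ e₁ e₂ e₃ f₁)
    (h₂ : Turn e₁ e₂ e₃ e₄ f₂) (h₃ : Turn e₂ e₃ e₄ e₅ f₃) (h₄ : Turn e₃ e₄ e₅ e₁ f₄)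
    (h₅ : Turn e₄ e₅ e₁ e₂ f₅) (hsum : e₁ + e₂ + e₃ + e₄ + e₅ = 0) : False := by
  rcases h₁.nonneg.lt_or_eq with d₁ | d₁
  swap
  · obtain rfl := h₁.eq d₁.symm
    exact not_turn_five_of_eq h₂ h₃ h₄ h₅ hsum
  rcases h₂.nonneg.lt_or_eq with d₂ | d₂
  swap
  · obtain rfl := h₂.eq d₂.symm
    exact not_turn_five_of_eq h₃ h₄ h₅ h₁ (by rw [← hsum]; abel)
  rcases h₃.nonneg.lt_or_eq with d₃ | d₃
  swap
  · obtain rfl := h₃.eq d₃.symm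
    exact not_turn_five_of_eq h₄ h₅ h₁ h₂ (by rw [← hsum]; abel)
  rcases h₄.nonneg.lt_or_eq with d₄ | d₄
  swap
  · obtain rfl := h₄.eq d₄.symm
    exact not_turn_five_of_eq h₅ h₁ h₂ h₃ (by rw [← hsum]; abel)
  rcases h₅.nonneg.lt_or_eq with d₅ | d₅
  swap
  · obtain rfl := h₅.eq d₅.symm
    exact not_turn_five_of_eq h₁ h₂ h₃ h₄ (by rw [← hsum]; abel)
  have c₁ := not_turn_five_of_cover d₁ d₂ d₅
  have c₂ := not_turn_five_of_cover d₂ d₃ d₁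
  have c₃ := not_turn_five_of_cover d₃ d₄ d₂
  have c₄ := not_turn_five_of_cover d₄ d₅ d₃
  have c₅ := not_turn_five_of_cover d₅ d₁ d₄
  have w₁ := h₁.wide_cross
  have w₂ := h₂.wide_cross
  have w₃ := h₃.wide_cross
  have w₄ := h₄.wide_cross
  have w₅ := h₅.wide_cross
  clear h₁ h₂ h₃ h₄ h₅ hsum
  omega

lemma exists_notMem_interior (hfin : Q.Finite) (hne : Q.Nonempty) : ∃ a ∈ Q, a ∉ latticeInterior Q := by
  obtain ⟨a, ha, hmax⟩ := hfin.exists_maximalFor (fun v => v.1) Q hne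
  refine ⟨a, ha, fun h => ?_⟩
  obtain ⟨v, hv, hlt⟩ := h 1 0 (by norm_num)
  have h1 : a.1 < v.1 := by
    have : (a.1 : ℝ) < v.1 := by linarith
    exact_mod_cast this
  exact absurd (hmax hv h1.le) (not_le.2 h1)

lemma WidthAtLeast.nonempty {k : ℤ} (hW : WidthAtLeast Q k) : Q.Nonempty := by
  obtain ⟨u, hu, -⟩ := hW 1 0 (by norm_num)
  exact ⟨u, hu⟩

lemma exists_next (hfin : Q.Finite) (hQ : LatticeConvex Q) (hW : WidthAtLeast Q 1) :
    ∃ nxt : ↥(Q \ latticeInterior Q) → ↥(Q \ latticeInterior Q),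
      ∀ a : ↥(Q \ latticeInterior Q), Adj Q a (nxt a) := by
  have : ∀ a : ↥(Q \ latticeInterior Q), ∃ b : ↥(Q \ latticeInterior Q), Adj Q a b := by
    rintro ⟨a, ha, haI⟩
    obtain ⟨b, hb⟩ := hQ.exists_adj hfin hW ha haI
    exact ⟨⟨b, hb.right_mem, hb.right_notMem_interior⟩, hb⟩
  choose nxt hnxt using this
  exact ⟨nxt, hnxt⟩

/-- A lattice polygon of width at least three that is the interior hull of another lattice polygon
has at least six boundary points. -/
lemma six_le_ncard_boundary (hL : LatticeConvex L) (hfin : (latticeInterior L).Finite)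
    (hW : WidthAtLeast (latticeInterior L) 3) :
    6 ≤ (latticeInterior L \ latticeInterior (latticeInterior L)).ncard := by
  set B := latticeInterior L \ latticeInterior (latticeInterior L) with hB
  obtain ⟨nxt, hadj⟩ : ∃ nxt : B → B, ∀ a : B, Adj (latticeInterior L) a (nxt a) :=
    exists_next hfin (latticeConvex_interior L) (hW.mono (by norm_num))
  obtain ⟨a₀, ha₀, ha₀I⟩ := exists_notMem_interior hfin hW.nonempty
  by_contra! hlt
  have hBfin : Finite B := (hfin.subset Set.sdiff_subset).to_subtype
  have hcard : Nat.card B < Nat.card (Fin 6) := by simpa using hlt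
  obtain ⟨i, j, hne, hij⟩ : ∃ i j : Fin 6, i ≠ j ∧
      nxt^[i] ⟨a₀, ha₀, ha₀I⟩ = nxt^[j] ⟨a₀, ha₀, ha₀I⟩ := by
    by_contra! h
    have hi : Function.Injective fun i : Fin 6 => nxt^[i] (⟨a₀, ha₀, ha₀I⟩ : B) := by
      intro i j hij
      by_contra hne
      exact h i j hne hij
    exact absurd (Nat.card_le_card_of_injective _ hi) (not_le.2 hcard)
  obtain ⟨a, n, hn0, hn6, hper⟩ : ∃ (a : B) (n : ℕ), 0 < n ∧ n < 6 ∧ nxt^[n] a = a := by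
    have main : ∀ i j : Fin 6, i < j → nxt^[i] ⟨a₀, ha₀, ha₀I⟩ = nxt^[j] ⟨a₀, ha₀, ha₀I⟩ →
        ∃ (a : B) (n : ℕ), 0 < n ∧ n < 6 ∧ nxt^[n] a = a := by
      intro i j hlt hij
      have hlt' : (i : ℕ) < j := hlt
      refine ⟨nxt^[i] ⟨a₀, ha₀, ha₀I⟩, j - i, by omega, by omega, ?_⟩
      rw [← Function.iterate_add_apply, Nat.sub_add_cancel hlt'.le, hij]
    rcases lt_or_gt_of_ne hne with h | h
    · exact main i j h hij
    · exact main j i h hij.symm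
  have hW1 := hW.mono (show (1 : ℤ) ≤ 3 by norm_num)
  have turn : ∀ p q r s t : B, nxt p = q → nxt q = r → nxt r = s → nxt s = t →
      ∃ f, Turn ((q : ℤ × ℤ) - p) ((r : ℤ × ℤ) - q) ((s : ℤ × ℤ) - r) ((t : ℤ × ℤ) - s) f := by
    rintro p q r s t rfl rfl rfl rfl
    exact (hadj _).exists_turn hL hW (hadj _) (hadj _) (hadj _)
  interval_cases n
  · have := hadj a
    simp only [Function.iterate_one] at hper
    rw [hper] at this
    exact this.not_symm hW1 this
  · have := hadj (nxt a)
    simp only [Function.iterate_succ, Function.iterate_zero, Function.comp, id] at hper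
    rw [hper] at this
    exact this.not_symm hW1 (hadj a)
  all_goals simp only [Function.iterate_succ, Function.iterate_zero, Function.comp, id] at hper
  · obtain ⟨f, h⟩ := turn _ _ _ _ _ hper rfl rfl hper
    exact not_turn_three h (by abel)
  · obtain ⟨f₁, h₁⟩ := turn _ _ _ _ _ hper rfl rfl rfl
    obtain ⟨f₂, h₂⟩ := turn _ _ _ _ _ rfl rfl rfl hper
    obtain ⟨f₃, h₃⟩ := turn _ _ _ _ _ rfl rfl hper rfl
    obtain ⟨f₄, h₄⟩ := turn _ _ _ _ _ rfl hper rfl rfl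
    exact not_turn_four h₁ h₂ h₃ h₄ (by abel)
  · obtain ⟨f₁, h₁⟩ := turn _ _ _ _ _ hper rfl rfl rfl
    obtain ⟨f₂, h₂⟩ := turn a _ _ _ _ rfl rfl rfl rfl
    obtain ⟨f₃, h₃⟩ := turn _ _ _ _ _ rfl rfl rfl hper
    obtain ⟨f₄, h₄⟩ := turn _ _ _ _ _ rfl rfl hper rfl
    obtain ⟨f₅, h₅⟩ := turn _ _ _ _ _ rfl hper rfl rfl
    exact not_turn_five h₁ h₂ h₃ h₄ h₅ (by abel)

end BoundaryCycle

section InteriorNonempty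

variable {L Q : Set (ℤ × ℤ)}

lemma interior_of_segment {a b c d p : ℤ × ℤ} (ha : a ∈ L) (hb : b ∈ L) (hc : c ∈ L) (hd : d ∈ L)
    (hpos : 0 < cross (b - a) (c - a)) (hneg : cross (b - a) (d - a) < 0) (α β : ℤ) (hα : 0 < α)
    (hβ : 0 < β) (h1 : (α + β) * p.1 = α * a.1 + β * b.1)
    (h2 : (α + β) * p.2 = α * a.2 + β * b.2) : p ∈ latticeInterior L := by
  intro s t hst
  by_contra! hcon
  have A := hcon a ha
  have B := hcon b hb
  have C := hcon c hc
  have D := hcon d hd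
  have h1' : ((α : ℝ) + β) * p.1 = α * a.1 + β * b.1 := by exact_mod_cast h1
  have h2' : ((α : ℝ) + β) * p.2 = α * a.2 + β * b.2 := by exact_mod_cast h2
  have hα' : (0 : ℝ) < α := by exact_mod_cast hα
  have hβ' : (0 : ℝ) < β := by exact_mod_cast hβ
  have key : (α : ℝ) * (s * ((a.1 : ℝ) - p.1) + t * ((a.2 : ℝ) - p.2))
      + β * (s * ((b.1 : ℝ) - p.1) + t * ((b.2 : ℝ) - p.2)) = 0 := by
    linear_combination -s * h1' - t * h2'
  have hA := mul_nonneg hα'.le (neg_nonneg.2 A)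
  have hB := mul_nonneg hβ'.le (neg_nonneg.2 B)
  have A0 : s * ((a.1 : ℝ) - p.1) + t * ((a.2 : ℝ) - p.2) = 0 := by
    have : (α : ℝ) * (s * ((a.1 : ℝ) - p.1) + t * ((a.2 : ℝ) - p.2)) = 0 := by linarith
    exact (mul_eq_zero.1 this).resolve_left hα'.ne'
  have B0 : s * ((b.1 : ℝ) - p.1) + t * ((b.2 : ℝ) - p.2) = 0 := by
    have : (β : ℝ) * (s * ((b.1 : ℝ) - p.1) + t * ((b.2 : ℝ) - p.2)) = 0 := by linarith
    exact (mul_eq_zero.1 this).resolve_left hβ'.ne'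
  have hpos' : (0 : ℝ) < (b.1 - a.1) * (c.2 - a.2) - (b.2 - a.2) * (c.1 - a.1) := by
    have : ((0 : ℤ) : ℝ) < ((cross (b - a) (c - a) : ℤ) : ℝ) := by exact_mod_cast hpos
    simpa [cross] using this
  have hneg' : (b.1 - a.1 : ℝ) * (d.2 - a.2) - (b.2 - a.2) * (d.1 - a.1) < 0 := by
    have : ((cross (b - a) (d - a) : ℤ) : ℝ) < ((0 : ℤ) : ℝ) := by exact_mod_cast hneg
    simpa [cross] using this
  have e : s * ((b.1 : ℝ) - a.1) + t * ((b.2 : ℝ) - a.2) = 0 := by linarith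
  set x : ℝ := (b.1 : ℝ) - a.1
  set y : ℝ := (b.2 : ℝ) - a.2
  have C' : s * ((c.1 : ℝ) - a.1) + t * ((c.2 : ℝ) - a.2) ≤ 0 := by linarith
  have D' : s * ((d.1 : ℝ) - a.1) + t * ((d.2 : ℝ) - a.2) ≤ 0 := by linarith
  have hxy : 0 < x * x + y * y := by
    by_contra! h
    have hx : x = 0 := by nlinarith [mul_self_nonneg x, mul_self_nonneg y]
    have hy : y = 0 := by nlinarith [mul_self_nonneg x, mul_self_nonneg y]
    rw [hx, hy] at hpos'
    linarith
  have hs : (x * x + y * y) * s = -(t * x - s * y) * y := by linear_combination x * e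
  have ht : (x * x + y * y) * t = (t * x - s * y) * x := by linear_combination y * e
  have hk : t * x - s * y ≠ 0 := by
    intro h0
    rw [h0] at hs ht
    rcases hst with h | h
    · exact h ((mul_eq_zero.1 (hs.trans (by ring))).resolve_left hxy.ne')
    · exact h ((mul_eq_zero.1 (ht.trans (by ring))).resolve_left hxy.ne')
  have C'' : (t * x - s * y) * (x * (c.2 - a.2) - y * (c.1 - a.1)) ≤ 0 := by
    have : (t * x - s * y) * (x * (c.2 - a.2) - y * (c.1 - a.1))
        = (x * x + y * y) * (s * ((c.1 : ℝ) - a.1) + t * ((c.2 : ℝ) - a.2)) := by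
      linear_combination (-((c.1 : ℝ) - a.1)) * hs - ((c.2 : ℝ) - a.2) * ht
    rw [this]
    exact mul_nonpos_of_nonneg_of_nonpos hxy.le C'
  have D'' : (t * x - s * y) * (x * (d.2 - a.2) - y * (d.1 - a.1)) ≤ 0 := by
    have : (t * x - s * y) * (x * (d.2 - a.2) - y * (d.1 - a.1))
        = (x * x + y * y) * (s * ((d.1 : ℝ) - a.1) + t * ((d.2 : ℝ) - a.2)) := by
      linear_combination (-((d.1 : ℝ) - a.1)) * hs - ((d.2 : ℝ) - a.2) * ht
    rw [this]
    exact mul_nonpos_of_nonneg_of_nonpos hxy.le D'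
  rcases hk.lt_or_gt with h | h
  · exact absurd (mul_pos_of_neg_of_neg h hneg') (not_lt.2 D'')
  · exact absurd (mul_pos h hpos') (not_lt.2 C'')

lemma interior_nonempty_of_axes {d : ℤ} (h0 : (0, 0) ∈ Q) (h1 : (1, 0) ∈ Q) (hd : (0, d) ∈ Q)
    (hd3 : 3 ≤ d) (hy : ∀ q ∈ Q, 0 ≤ q.2) (hW : WidthAtLeast Q 3) : (latticeInterior Q).Nonempty := by
  by_cases hx : ∀ q ∈ Q, 0 ≤ q.1
  · obtain ⟨⟨x, y⟩, hu, ⟨x', y'⟩, hv, huv⟩ := hW 1 0 (by norm_num)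
    have := hx _ hv
    have hx3 : 3 ≤ x := by simp only at *; linarith
    have hy0 : 0 ≤ y := hy _ hu
    have hm0 := Int.emod_nonneg y (show x ≠ 0 by linarith)
    have hm1 := Int.emod_lt_of_pos y (show 0 < x by linarith)
    have hdm := Int.emod_add_mul_ediv y x
    set r := y % x
    set j := y / x
    refine ⟨(1, j + 1), interior_of_triangle h0 hd hu ?_ (d * x - d - (x - r)) (x - r) d ?_ ?_ ?_
      ?_ ?_⟩
    · simp only [cross, Prod.fst_sub, Prod.snd_sub]
      nlinarith
    · nlinarith
    · linarith
    · linarith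
    · simp only; ring
    · simp only; linear_combination d * hdm
  · push Not at hx
    obtain ⟨q, hq, hq0⟩ := hx
    refine ⟨(0, 1), interior_of_segment h0 hd hq h1 ?_ ?_ (d - 1) 1 ?_ ?_ ?_ ?_⟩
    · simp only [cross, Prod.fst_sub, Prod.snd_sub]; nlinarith
    · simp only [cross, Prod.fst_sub, Prod.snd_sub]; nlinarith
    · linarith
    · norm_num
    · simp
    · simp

lemma interior_nonempty_of_edge (h0 : (0, 0) ∈ Q) (h1 : (1, 0) ∈ Q)
    (hy : ∀ q ∈ Q, 0 ≤ q.2) (hW : WidthAtLeast Q 3) : (latticeInterior Q).Nonempty := by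
  obtain ⟨⟨x, d⟩, hv, ⟨x', d'⟩, hu, huv⟩ := hW 0 1 (by norm_num)
  have := hy _ hu
  have hd3 : 3 ≤ d := by simp only at *; linarith
  have hd0 : (0 : ℤ) < d := by linarith
  have hβ := Int.emod_nonneg (-x) hd0.ne'
  have hβ' := Int.emod_lt_of_pos (-x) hd0
  have hdm := Int.emod_add_mul_ediv (-x) d
  set β := (-x) % d
  set m := (-x) / d
  have rechart : ∀ o u w : ℤ × ℤ, cross u w = 1 ∨ cross u w = -1 → o.2 = 0 → u.2 = 0 → w.2 = 1 →
      o ∈ Q → (o.1 + u.1, o.2 + u.2) ∈ Q → (o.1 + d * w.1, d) ∈ Q → (latticeInterior Q).Nonempty := by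
    intro o u w huw ho hu hw ho' hu' hv'
    obtain ⟨p, hp⟩ := interior_nonempty_of_axes (Q := chart o u w ⁻¹' Q) (d := d)
      (by simpa [chart] using ho') (by simpa [chart] using hu')
      (by simpa [chart, ho, hu, hw] using hv') hd3
      (fun q hq => by simpa [chart, ho, hu, hw] using hy _ hq) (hW.chart huw)
    rw [latticeInterior_chart huw] at hp
    exact ⟨_, hp⟩
  rcases hβ.lt_or_eq with hpos | hzero
  · rcases (show β ≤ d - 1 by linarith).lt_or_eq with hlt | heq
    · refine ⟨(-m, 1), interior_of_triangle h0 h1 hv ?_ (d - 1 - β) β 1 (by linarith) hpos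
        (by norm_num) ?_ ?_⟩
      · simp only [cross, Prod.fst_sub, Prod.snd_sub]; linarith
      · simp only; linear_combination -hdm
      · simp
    · refine rechart (1, 0) (-1, 0) (-m - 1, 1) (by simp [cross]) rfl rfl rfl h1 (by simpa using h0) ?_
      have : (1 : ℤ) + d * (-m - 1) = x := by linarith
      simpa [this] using hv
  · refine rechart (0, 0) (1, 0) (-m, 1) (by simp [cross]) rfl rfl rfl h0 (by simpa using h1) ?_
    have : (0 : ℤ) + d * (-m) = x := by linarith
    rw [← this] at hv
    exact hv

lemma exists_cross_eq_one {e : ℤ × ℤ} (he : IsCoprime e.1 e.2) : ∃ g, cross e g = 1 := by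
  obtain ⟨r, s, hrs⟩ := he
  exact ⟨(-s, r), by simp only [cross]; linear_combination hrs⟩

lemma cross_chart (o u w p : ℤ × ℤ) : cross u (chart o u w p - o) = p.2 * cross u w := by
  simp only [chart, cross, Prod.fst_sub, Prod.snd_sub]; ring

lemma LatticeConvex.interior_nonempty (hQ : LatticeConvex Q) (hfin : Q.Finite)
    (hW : WidthAtLeast Q 3) : (latticeInterior Q).Nonempty := by
  obtain ⟨a, ha, haI⟩ := exists_notMem_interior hfin hW.nonempty
  obtain ⟨b, hb⟩ := hQ.exists_adj hfin (hW.mono (by norm_num)) ha haI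
  obtain ⟨g, hg⟩ := exists_cross_eq_one hb.coprime
  obtain ⟨p, hp⟩ := interior_nonempty_of_edge (Q := _root_.chart a (b - a) g ⁻¹' Q)
    (by simpa [_root_.chart] using ha) (by simpa [_root_.chart] using hb.right_mem)
    (fun q hq => by simpa [cross_chart, hg] using hb.nonneg _ hq) (hW.chart (Or.inl hg))
  rw [latticeInterior_chart (Or.inl hg)] at hp
  exact ⟨_, hp⟩

end InteriorNonempty

section Reflexive

variable {L Q : Set (ℤ × ℤ)} {k : ℤ}

/-- The lattice points of the `k`-fold dilated standard triangle. -/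
noncomputable def simplexPoints (k : ℤ) : Finset (ℤ × ℤ) :=
  (Finset.Icc 0 k ×ˢ Finset.Icc 0 k).filter fun p => p.1 + p.2 ≤ k

lemma mem_simplexPoints {p : ℤ × ℤ} :
    p ∈ simplexPoints k ↔ 0 ≤ p.1 ∧ 0 ≤ p.2 ∧ p.1 + p.2 ≤ k := by
  simp only [simplexPoints, Finset.mem_filter, Finset.mem_product, Finset.mem_Icc]
  omega

lemma LatticeConvex.simplexPoints_subset (hQ : LatticeConvex Q) (hk : 0 < k) (h0 : (0, 0) ∈ Q)
    (h1 : (k, 0) ∈ Q) (h2 : (0, k) ∈ Q) : ↑(simplexPoints k) ⊆ Q := by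
  intro p hp
  obtain ⟨hx, hy, hxy⟩ := mem_simplexPoints.1 (Finset.mem_coe.1 hp)
  refine hQ.combo h0 h1 h2 (k - p.1 - p.2) p.1 p.2 (by linarith) hx hy (by linarith) ?_ ?_ <;>
  · simp only; ring

lemma card_simplexPoints_three : (simplexPoints 3).card = 10 := by decide +kernel

lemma ten_le_of_edge (hQ : LatticeConvex Q) (hfin : Q.Finite)
    (hI : (latticeInterior Q).Subsingleton) {n : ℤ} (hn : 3 ≤ n) (h0 : (0, 0) ∈ Q)
    (h1 : (n, 0) ∈ Q) (hy : ∀ q ∈ Q, 0 ≤ q.2) (hW : WidthAtLeast Q 3) :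
    10 ≤ Q.ncard ∧ ¬ WidthAtLeast Q 4 := by
  have h3 : (3, 0) ∈ Q := hQ.combo h0 h1 h1 (n - 3) 3 0 (by linarith) (by norm_num) le_rfl
    (by linarith) (by simp only; ring) (by simp)
  have key : ∀ x h, (x, h) ∈ Q → 3 ≤ h → h = 3 ∧ x % 3 = 0 := by
    intro x h hv hh
    have hr0 := Int.emod_nonneg x (show h ≠ 0 by linarith)
    have hr1 := Int.emod_lt_of_pos x (show 0 < h by linarith)
    have hdm := Int.emod_add_mul_ediv x h
    have hlt : h - 3 + x % h ≤ 0 := by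
      by_contra! hpos
      set r := x % h
      set j := x / h
      have i1 : (j + 1, 1) ∈ latticeInterior Q := by
        refine interior_of_triangle h0 h3 hv ?_ (2 * h - 3 + r) (h - r) 3 (by linarith)
          (by linarith) (by norm_num) ?_ ?_
        · simp only [cross, Prod.fst_sub, Prod.snd_sub]; linarith
        · simp only; linear_combination 3 * hdm
        · simp only; ring
      have i2 : (j + 2, 1) ∈ latticeInterior Q := by
        refine interior_of_triangle h0 h3 hv ?_ (h - 3 + r) (2 * h - r) 3 (by linarith)
          (by linarith) (by norm_num) ?_ ?_
        · simp only [cross, Prod.fst_sub, Prod.snd_sub]; linarith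
        · simp only; linear_combination 3 * hdm
        · simp only; ring
      have := congrArg Prod.fst (hI i1 i2)
      simp at this
    have h3' : h = 3 := by linarith
    subst h3'
    exact ⟨rfl, by linarith⟩
  constructor
  · obtain ⟨⟨x, h⟩, hv, ⟨x', h'⟩, hu, huv⟩ := hW 0 1 (by norm_num)
    have := hy _ hu
    obtain ⟨rfl, hx⟩ := key x h hv (by simp only at *; linarith)
    have hdet : cross (1, 0) (x / 3, 1) = 1 ∨ cross (1, 0) (x / 3, 1) = -1 := by simp [cross]
    have hsub := (hQ.chart (o := 0) (u := (1, 0)) (w := (x / 3, 1))).simplexPoints_subset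
      (k := 3) (by norm_num) (by simpa [_root_.chart] using h0) (by simpa [_root_.chart] using h3)
      (by
        have : 3 * (x / 3) = x := by omega
        simpa [_root_.chart, this] using hv)
    rw [← ncard_chart_preimage (o := 0) hdet, ← card_simplexPoints_three,
      ← Set.ncard_coe_finset]
    exact Set.ncard_le_ncard hsub (hfin.preimage (chart_bijective hdet).1.injOn)
  · intro hW4
    obtain ⟨⟨x, h⟩, hv, ⟨x', h'⟩, hu, huv⟩ := hW4 0 1 (by norm_num)
    have := hy _ hu
    have := key x h hv (by simp only at *; linarith)
    simp only at *
    linarith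

lemma ten_le_of_row (hQ : LatticeConvex Q) (hfin : Q.Finite) (hW : WidthAtLeast Q 3)
    (hI : (latticeInterior Q).Subsingleton) {c d e : ℤ × ℤ} {n : ℤ} (hn : 3 ≤ n) (hc : c ∈ Q)
    (hd : d ∈ Q) (he : IsCoprime e.1 e.2) (hde : d = (c.1 + n * e.1, c.2 + n * e.2))
    (hce : c + e ∉ latticeInterior Q) : 10 ≤ Q.ncard ∧ ¬ WidthAtLeast Q 4 := by
  obtain ⟨g, hg⟩ := exists_cross_eq_one he
  have main : ∀ w, cross e w = 1 ∨ cross e w = -1 → (∀ q ∈ Q, 0 ≤ cross e w * cross e (q - c)) →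
      10 ≤ Q.ncard ∧ ¬ WidthAtLeast Q 4 := by
    intro w hw hpos
    have hw2 : cross e w * cross e w = 1 := by rcases hw with h | h <;> rw [h] <;> norm_num
    obtain ⟨h1, h2⟩ := ten_le_of_edge (Q := chart c e w ⁻¹' Q) hQ.chart
      (hfin.preimage (chart_bijective hw).1.injOn) (by
        rw [latticeInterior_chart hw]
        exact hI.preimage (chart_bijective hw).1) hn (by simpa [chart] using hc)
      (by simpa [chart, ← hde] using hd)
      (fun q hq => by
        have := hpos _ hq
        rw [cross_chart] at this
        have e1 : cross e w * (q.2 * cross e w) = q.2 := by linear_combination q.2 * hw2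
        rwa [e1] at this) (hW.chart hw)
    rw [ncard_chart_preimage hw] at h1
    exact ⟨h1, fun h => h2 (h.chart hw)⟩
  by_cases hpos : ∀ q ∈ Q, 0 ≤ cross e (q - c)
  · exact main g (Or.inl hg) fun q hq => by rw [hg, one_mul]; exact hpos q hq
  by_cases hneg : ∀ q ∈ Q, cross e (q - c) ≤ 0
  · have hg' : cross e (-g) = -1 := by
      rw [← hg]; simp only [cross, Prod.fst_neg, Prod.snd_neg]; ring
    exact main (-g) (Or.inr hg') fun q hq => by rw [hg']; linarith [hneg q hq]
  push Not at hpos hneg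
  obtain ⟨q, hq, hq0⟩ := hpos
  obtain ⟨q', hq', hq0'⟩ := hneg
  have hcr : ∀ q, cross (d - c) (q - c) = n * cross e (q - c) := by
    intro q
    rw [hde]
    simp only [cross, Prod.fst_sub, Prod.snd_sub]; ring
  refine absurd (interior_of_segment hc hd hq' hq ?_ ?_ (n - 1) 1 (by linarith) (by norm_num)
    ?_ ?_) hce
  · rw [hcr]; nlinarith
  · rw [hcr]; nlinarith
  · simp only [hde, Prod.fst_add]; ring
  · simp only [hde, Prod.snd_add]; ring

/-- A lattice polygon with the origin as its only interior lattice point, in coordinates in which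
the segment from `(1, 0)` to `(0, 1)` lies on the boundary. -/
structure ReflexiveChart (Q : Set (ℤ × ℤ)) : Prop where
  convex : LatticeConvex Q
  finite : Q.Finite
  width : WidthAtLeast Q 3
  interior : latticeInterior Q = {(0, 0)}
  e₁ : (1, 0) ∈ Q
  e₂ : (0, 1) ∈ Q
  le_one : ∀ x y, (x, y) ∈ Q → x + y ≤ 1

namespace ReflexiveChart

lemma preimage_swap (h : ReflexiveChart Q) :
    ReflexiveChart (chart (0, 0) (0, 1) (1, 0) ⁻¹' Q) := by
  have hdet : cross (0, 1) (1, 0) = 1 ∨ cross (0, 1) (1, 0) = -1 := by simp [cross]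
  refine ⟨h.convex.chart, h.finite.preimage (chart_bijective hdet).1.injOn, h.width.chart hdet, ?_,
    by simpa [chart] using h.e₂, by simpa [chart] using h.e₁, fun x y hxy => ?_⟩
  · rw [latticeInterior_chart hdet, h.interior]
    ext ⟨x, y⟩
    simp only [chart, Set.mem_preimage, Set.mem_singleton_iff, Prod.mk.injEq]
    constructor <;> rintro ⟨h1, h2⟩ <;> constructor <;> linarith
  · have := h.le_one y x (by simpa [chart] using hxy)
    linarith

lemma not_combo (h : ReflexiveChart Q) {b c q : ℤ × ℤ} (hb : b ∈ Q) (hc : c ∈ Q) (α β γ : ℤ)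
    (hα : 0 < α) (hβ : 0 ≤ β) (hγ : 0 ≤ γ) (h1 : (α + β + γ) * q.1 = β * b.1 + γ * c.1)
    (h2 : (α + β + γ) * q.2 = β * b.2 + γ * c.2) (hq : q ≠ (0, 0)) : False := by
  have h0 : ((0, 0) : ℤ × ℤ) ∈ latticeInterior Q := by rw [h.interior]; rfl
  have := interior_combo h0 hb hc α β γ hα hβ hγ (q := q) (by simpa using h1) (by simpa using h2)
  rw [h.interior] at this
  exact hq this

lemma row (h : ReflexiveChart Q) {c d : ℤ × ℤ} (e : ℤ × ℤ) (n : ℤ) (hn : 3 ≤ n) (hc : c ∈ Q)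
    (hd : d ∈ Q) (he : IsCoprime e.1 e.2) (h1 : d.1 = c.1 + n * e.1) (h2 : d.2 = c.2 + n * e.2)
    (hce : c + e ≠ (0, 0)) : 10 ≤ Q.ncard ∧ ¬ WidthAtLeast Q 4 :=
  ten_le_of_row h.convex h.finite h.width (by rw [h.interior]; exact Set.subsingleton_singleton)
    hn hc hd he (Prod.ext h1 h2) (by rw [h.interior]; exact hce)

lemma of_le_neg_two (h : ReflexiveChart Q) {x y : ℤ} (hv : (x, y) ∈ Q) (hy : y ≤ -2) :
    (10 ≤ Q.ncard ∧ ¬ WidthAtLeast Q 4) ∨ (x = 1 ∧ y = -2) ∨ (x = -1 ∧ y = -2) := by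
  have hle := h.le_one x y hv
  have c11 : IsCoprime (1 : ℤ) 1 := isCoprime_one_left
  rcases lt_trichotomy x 0 with hx | rfl | hx
  · rcases lt_trichotomy x y with hxy | rfl | hxy
    · by_cases h1 : x = y - 1
      · by_cases h2 : y = -2
        · left
          exact h.row (1, 1) 3 le_rfl hv h.e₂ c11 (by simp only; omega) (by simp only; omega)
            (by simp [Prod.ext_iff]; omega)
        · exact (h.not_combo hv h.e₁ (-y - 2) 1 1 (by omega) (by omega) (by omega) (q := (-1, -1))
            (by simp only; omega) (by simp only; omega) (by simp)).elim
      · exact (h.not_combo hv h.e₂ (-x - 1 + y) 1 (-y) (by omega) (by omega) (by omega)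
            (q := (-1, 0)) (by simp only; omega) (by simp only; omega) (by simp)).elim
    · exact (h.not_combo hv hv (-x - 1) 1 0 (by omega) (by omega) (by omega) (q := (-1, -1))
            (by simp only; omega) (by simp only; omega) (by simp)).elim
    · by_cases h1 : y = x - 1
      · by_cases h2 : x = -2
        · left
          exact h.row (1, 1) 3 le_rfl hv h.e₁ c11 (by simp only; omega) (by simp only; omega)
            (by simp [Prod.ext_iff]; omega)
        by_cases h3 : x = -1
        · right; right; omega
        · exact (h.not_combo hv h.e₂ (-x - 2) 1 1 (by omega) (by omega) (by omega) (q := (-1, -1))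
            (by simp only; omega) (by simp only; omega) (by simp)).elim
      · exact (h.not_combo hv h.e₁ (-y - 1 + x) 1 (-x) (by omega) (by omega) (by omega)
            (q := (0, -1)) (by simp only; omega) (by simp only; omega) (by simp)).elim
  · exact (h.not_combo hv hv (-y - 1) 1 0 (by omega) (by omega) (by omega) (q := (0, -1))
            (by simp only; omega) (by simp only; omega) (by simp)).elim
  · by_cases h1 : x = 1
    · subst h1
      by_cases h2 : y = -2
      · right; left; exact ⟨rfl, h2⟩
      · left
        exact h.row (0, 1) (-y) (by omega) hv h.e₁ isCoprime_one_right (by simp only; omega)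
          (by simp only; omega) (by simp)
    · by_cases h2 : x + y = 1
      · left
        exact h.row (1, -1) x (by omega) h.e₂ hv isCoprime_one_left (by simp only; omega)
          (by simp only; omega) (by simp)
      · exact (h.not_combo hv h.e₁ (x - 1) 1 (-x - y) (by omega) (by omega) (by omega)
          (q := (1, -1)) (by simp only; ring) (by simp only; ring) (by simp)).elim

lemma of_left_le_neg_two (h : ReflexiveChart Q) {x y : ℤ} (hv : (x, y) ∈ Q) (hx : x ≤ -2) :
    (10 ≤ Q.ncard ∧ ¬ WidthAtLeast Q 4) ∨ (y = 1 ∧ x = -2) ∨ (y = -1 ∧ x = -2) := by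
  have hdet : cross (0, 1) (1, 0) = 1 ∨ cross (0, 1) (1, 0) = -1 := by simp [cross]
  rcases h.preimage_swap.of_le_neg_two (x := y) (y := x) (by simpa [chart] using hv) hx with h' | h'
  · rw [ncard_chart_preimage hdet] at h'
    exact Or.inl ⟨h'.1, fun hW => h'.2 (hW.chart hdet)⟩
  · exact Or.inr h'

lemma of_neg_two_neg_one_mem (h : ReflexiveChart Q) (hv : (-2, -1) ∈ Q) :
    10 ≤ Q.ncard ∧ ¬ WidthAtLeast Q 4 := by
  have h0 : (0, 0) ∈ Q := by
    refine h.convex.interior_subset ⟨_, hv⟩ ?_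
    rw [h.interior]; rfl
  have h1 : ∀ x y, (x, y) ∈ Q → y - x ≤ 1 := by
    intro x y hxy
    by_contra! hlt
    have := interior_of_segment (p := (-1, 0)) hv h.e₂ hxy h0
      (by simp only [cross, Prod.fst_sub, Prod.snd_sub]; linarith)
      (by simp [cross]) 1 1 (by norm_num) (by norm_num) (by simp) (by simp)
    rw [h.interior] at this
    simp at this
  obtain ⟨⟨x', y'⟩, hu, ⟨x, y⟩, hs, hus⟩ := h.width 0 1 (by norm_num)
  have a1 := h.le_one _ _ hu
  have a2 := h1 _ _ hu
  rcases h.of_le_neg_two hs (by simp only at *; omega) with hC | ⟨rfl, rfl⟩ | ⟨rfl, rfl⟩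
  · exact hC
  · exact (h.not_combo hv hs 1 3 1 (by norm_num) (by norm_num) (by norm_num) (q := (-1, -1))
      (by simp) (by simp) (by simp)).elim
  · have h2 : ∀ x y, (x, y) ∈ Q → x - y ≤ 1 := by
      intro x y hxy
      by_contra! hlt
      have := interior_of_segment (p := (0, -1)) h.e₁ hs hxy h0
        (by simp only [cross, Prod.fst_sub, Prod.snd_sub]; linarith)
        (by simp [cross]) 1 1 (by norm_num) (by norm_num) (by simp) (by simp)
      rw [h.interior] at this
      simp at this
    obtain ⟨⟨x', y'⟩, hu, ⟨x, y⟩, hs, hus⟩ := h.width (-1) 1 (by norm_num)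
    have b1 := h1 _ _ hu
    have b2 := h2 _ _ hs
    simp only at *
    omega

lemma of_neg_one_neg_two_mem (h : ReflexiveChart Q) (hv : (-1, -2) ∈ Q) :
    10 ≤ Q.ncard ∧ ¬ WidthAtLeast Q 4 := by
  have hdet : cross (0, 1) (1, 0) = 1 ∨ cross (0, 1) (1, 0) = -1 := by simp [cross]
  have h' := h.preimage_swap.of_neg_two_neg_one_mem (by simpa [chart] using hv)
  rw [ncard_chart_preimage hdet] at h'
  exact ⟨h'.1, fun hW => h'.2 (hW.chart hdet)⟩

lemma conclusion (h : ReflexiveChart Q) : 10 ≤ Q.ncard ∧ ¬ WidthAtLeast Q 4 := by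
  by_contra hC
  have hy : ∀ x y, (x, y) ∈ Q → y ≤ -2 → x = 1 ∧ y = -2 := by
    intro x y hxy hy
    rcases h.of_le_neg_two hxy hy with h' | h' | ⟨rfl, rfl⟩
    · exact absurd h' hC
    · exact h'
    · exact absurd (h.of_neg_one_neg_two_mem hxy) hC
  have hx : ∀ x y, (x, y) ∈ Q → x ≤ -2 → y = 1 ∧ x = -2 := by
    intro x y hxy hx
    rcases h.of_left_le_neg_two hxy hx with h' | h' | ⟨rfl, rfl⟩
    · exact absurd h' hC
    · exact h'
    · exact absurd (h.of_neg_two_neg_one_mem hxy) hC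
  have hm : (-1, -1) ∈ Q := by
    obtain ⟨⟨x', y'⟩, hu, ⟨x, y⟩, hs, hus⟩ := h.width 1 1 (by norm_num)
    have h1 := h.le_one _ _ hu
    have h2 := hx _ _ hs
    have h3 := hy _ _ hs
    simp only at *
    have e1 : x = -1 := by omega
    have e2 : y = -1 := by omega
    rwa [e1, e2] at hs
  have hx' : ∀ x y, (x, y) ∈ Q → -1 ≤ x := by
    intro x y hxy
    by_contra! hlt
    obtain ⟨rfl, rfl⟩ := hx _ _ hxy (by omega)
    exact h.not_combo hxy hm 1 1 1 (by norm_num) (by norm_num) (by norm_num) (q := (-1, 0))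
      (by simp) (by simp) (by simp)
  have hy' : ∀ x y, (x, y) ∈ Q → -1 ≤ y := by
    intro x y hxy
    by_contra! hlt
    obtain ⟨rfl, rfl⟩ := hy _ _ hxy (by omega)
    exact h.not_combo hxy hm 1 1 1 (by norm_num) (by norm_num) (by norm_num) (q := (0, -1))
      (by simp) (by simp) (by simp)
  have m1 : (2, -1) ∈ Q := by
    obtain ⟨⟨x, y⟩, hu, ⟨x', y'⟩, hs, hus⟩ := h.width 1 0 (by norm_num)
    have h1 := h.le_one _ _ hu
    have h2 := hy' _ _ hu
    have h3 := hx' _ _ hs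
    simp only at *
    have e1 : x = 2 := by omega
    have e2 : y = -1 := by omega
    rwa [e1, e2] at hu
  have m2 : (-1, 2) ∈ Q := by
    obtain ⟨⟨x, y⟩, hu, ⟨x', y'⟩, hs, hus⟩ := h.width 0 1 (by norm_num)
    have h1 := h.le_one _ _ hu
    have h2 := hx' _ _ hu
    have h3 := hy' _ _ hs
    simp only at *
    have e1 : x = -1 := by omega
    have e2 : y = 2 := by omega
    rwa [e1, e2] at hu
  exact hC (h.row (1, -1) 3 le_rfl m2 m1 isCoprime_one_left (by simp) (by simp) (by simp))

end ReflexiveChart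

/-- A lattice polygon of width at least three with a single interior lattice point is the
threefold standard triangle; in particular it has ten lattice points and width three. -/
lemma LatticeConvex.ten_le_of_interior_eq_singleton (hQ : LatticeConvex Q) (hfin : Q.Finite)
    (hW : WidthAtLeast Q 3) {o : ℤ × ℤ} (hI : latticeInterior Q = {o}) :
    10 ≤ Q.ncard ∧ ¬ WidthAtLeast Q 4 := by
  have hoI : o ∈ latticeInterior Q := by rw [hI]; rfl
  have ho := hQ.interior_subset hW.nonempty hoI
  obtain ⟨a, ha, haI⟩ := exists_notMem_interior hfin hW.nonempty
  obtain ⟨b, hb⟩ := hQ.exists_adj hfin (hW.mono (by norm_num)) ha haI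
  have hpos : 0 < cross (b - a) (o - a) := by
    refine (hb.nonneg o ho).lt_of_ne fun h => ?_
    refine notMem_interior_of_cross_nonneg hb.ne_zero (fun q hq => ?_) hoI
    have := hb.nonneg q hq
    simp only [cross, Prod.fst_sub, Prod.snd_sub] at *
    linarith
  have hone : cross (b - a) (o - a) = 1 := by
    by_contra hne
    obtain ⟨p, α, β, hα, hβ, hsum, hp, h1, h2⟩ := exists_height_one_vector hb.coprime hpos
    have hs : 1 + α + β = cross (b - a) (o - a) := by linarith
    simp only [Prod.fst_sub, Prod.snd_sub] at h1 h2
    have hmem : a + p ∈ latticeInterior Q := by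
      refine interior_combo hoI ha hb.right_mem 1 α β (by norm_num) hα hβ ?_ ?_
      · rw [hs, Prod.fst_add]; linear_combination h1 - a.1 * hs
      · rw [hs, Prod.snd_add]; linear_combination h2 - a.2 * hs
    rw [hI, Set.mem_singleton_iff] at hmem
    rw [← hmem, add_sub_cancel_left] at hne
    exact hne hp
  have hdet : cross (a - o) (b - o) = 1 := by
    rw [← hone]; simp only [cross, Prod.fst_sub, Prod.snd_sub]; ring
  have hchart : ReflexiveChart (_root_.chart o (a - o) (b - o) ⁻¹' Q) := by
    refine ⟨hQ.chart, hfin.preimage (chart_bijective (Or.inl hdet)).1.injOn,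
      hW.chart (Or.inl hdet), ?_, ?_, ?_, fun x y hxy => ?_⟩
    · rw [latticeInterior_chart (Or.inl hdet), hI]
      have : o = _root_.chart o (a - o) (b - o) (0, 0) := by simp [_root_.chart]
      ext p
      rw [Set.mem_preimage, Set.mem_singleton_iff, Set.mem_singleton_iff]
      exact ⟨fun hp => (chart_bijective (o := o) (Or.inl hdet)).1 (hp.trans this),
        fun hp => by rw [hp, ← this]⟩
    · simpa [_root_.chart] using ha
    · simpa [_root_.chart] using hb.right_mem
    · have h1 := hb.nonneg _ hxy
      have h2 : cross (b - a) (_root_.chart o (a - o) (b - o) (x, y) - a)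
          = (1 - x - y) * cross (a - o) (b - o) := by
        simp only [_root_.chart, cross, Prod.fst_sub, Prod.snd_sub]; ring
      rw [h2, hdet] at h1
      linarith
  obtain ⟨h1, h2⟩ := hchart.conclusion
  rw [ncard_chart_preimage (Or.inl hdet)] at h1
  exact ⟨h1, fun h => h2 (h.chart (Or.inl hdet))⟩

end Reflexive

section SmallCounts

variable {L Q : Set (ℤ × ℤ)} {k : ℤ}

lemma LatticeConvex.widthAtLeast_one_interior (hL : LatticeConvex L) (hW : WidthAtLeast L 3)
    {a b : ℤ × ℤ} (ha : a ∈ latticeInterior L) (hb : b ∈ latticeInterior L) (hab : b ≠ a) :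
    WidthAtLeast (latticeInterior L) 1 := by
  intro A B hAB
  by_contra! hcon
  have hconst : ∀ u ∈ latticeInterior L, A * (u.1 - a.1) + B * (u.2 - a.2) = 0 := by
    intro u hu
    have h1 := hcon u hu a ha
    have h2 := hcon a ha u hu
    linarith
  obtain ⟨e, g, hg, he, h1, h2⟩ := exists_isCoprime_mul (sub_ne_zero.2 hab)
  simp only [Prod.fst_sub, Prod.snd_sub] at h1 h2
  have hae : a + e ∈ latticeInterior L := by
    refine (latticeConvex_interior L).combo ha hb hb (g - 1) 1 0 (by linarith) zero_le_one le_rfl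
      (by linarith) ?_ ?_
    · rw [Prod.fst_add]; linear_combination -h1
    · rw [Prod.snd_add]; linear_combination -h2
  have hAe : A * e.1 + B * e.2 = 0 := by simpa using hconst _ hae
  have hline : ∀ u ∈ latticeInterior L, cross e (u - a) = 0 := by
    intro u hu
    have hu' := hconst u hu
    simp only [cross, Prod.fst_sub, Prod.snd_sub]
    rcases hAB with h | h
    · refine (mul_eq_zero.1 (?_ : A * _ = 0)).resolve_left h
      linear_combination (u.2 - a.2) * hAe - e.2 * hu'
    · refine (mul_eq_zero.1 (?_ : B * _ = 0)).resolve_left h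
      linear_combination -(u.1 - a.1) * hAe + e.1 * hu'
  have hadj : Adj (latticeInterior L) a (a + e) :=
    ⟨ha, hae, by simpa using he, fun q hq => by simpa using (hline q hq).ge⟩
  have hadj' : Adj (latticeInterior L) (a + e) a := by
    refine ⟨hae, ha, by simpa using he.neg_neg, fun q hq => ?_⟩
    rw [cross_reverse, add_sub_cancel_left, hline q hq, neg_zero]
  obtain ⟨u, hu, v, hv, h3⟩ := hW.exists_cross hadj.ne_zero
  have hu' := hadj'.neg_one_le hL hu
  have hv' := hadj.neg_one_le hL hv
  rw [cross_reverse] at hu'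
  simp only [cross, Prod.fst_sub, Prod.snd_sub] at hu' hv' h3
  linarith

lemma WidthAtLeast.three_le_ncard (hW : WidthAtLeast Q 1) (hfin : Q.Finite) : 3 ≤ Q.ncard := by
  obtain ⟨u, hu, v, hv, huv⟩ := hW 1 0 (by norm_num)
  have hne : u.1 - v.1 ≠ 0 := by intro h; rw [h] at huv; linarith
  have hne' : u ≠ v := by rintro rfl; simp at hne
  obtain ⟨r, hr, hru, hrv⟩ : ∃ r ∈ Q, r ≠ u ∧ r ≠ v := by
    obtain ⟨p, hp, q, hq, hpq⟩ := hW.exists_cross (e := u - v) (Or.inl hne)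
    by_contra! hcon
    simp only [cross, Prod.fst_sub, Prod.snd_sub] at hpq
    have key : ∀ p ∈ Q, (u.1 - v.1) * (p.2 - u.2) - (u.2 - v.2) * (p.1 - u.1) = 0 := by
      intro p hp
      by_cases h : p = u
      · rw [h]; ring
      · rw [hcon p hp h]; ring
    linarith [key p hp, key q hq]
  rw [← Set.ncard_eq_three.2 ⟨u, v, r, hne', hru.symm, hrv.symm, rfl⟩]
  exact Set.ncard_le_ncard (by rintro x (rfl | rfl | rfl) <;> assumption) hfin

lemma LatticeConvex.four_le_ncard (hQ : LatticeConvex Q) (hfin : Q.Finite)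
    (hW : WidthAtLeast Q 2) : 4 ≤ Q.ncard := by
  obtain ⟨a, ha, haI⟩ := exists_notMem_interior hfin hW.nonempty
  obtain ⟨b, hb⟩ := hQ.exists_adj hfin (hW.mono (by norm_num)) ha haI
  obtain ⟨v, hv, hv2⟩ := hb.exists_height hW
  obtain ⟨p, hp, hp1⟩ := hQ.exists_height_one ha hb.right_mem hv hb.coprime (by linarith)
  have hab : a ≠ b := by
    rintro rfl
    have := hb.ne_zero
    simp at this
  have h0 : cross (b - a) (a - a) = 0 := by simp
  have h1 : cross (b - a) (b - a) = 0 := by simp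
  have hap : a ≠ p := by rintro rfl; linarith
  have hav : a ≠ v := by rintro rfl; linarith
  have hbp : b ≠ p := by rintro rfl; linarith
  have hbv : b ≠ v := by rintro rfl; linarith
  have hpv : p ≠ v := by rintro rfl; linarith
  have : ({a, b, p, v} : Finset (ℤ × ℤ)).card = 4 := by
    simp [hab, hap, hav, hbp, hbv, hpv]
  rw [← this, ← Set.ncard_coe_finset]
  refine Set.ncard_le_ncard ?_ hfin
  intro x hx
  simp only [Finset.coe_insert, Finset.coe_singleton, Set.mem_insert_iff,
    Set.mem_singleton_iff] at hx
  rcases hx with rfl | rfl | rfl | rfl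
  exacts [ha, hb.right_mem, hp, hv]

end SmallCounts

section Simplex

variable {L : Set (ℤ × ℤ)} {k : ℤ}

/-- `L` is unimodularly equivalent to the lattice points of the `k`-th dilate of the standard
triangle. -/
def IsSimplex (k : ℤ) (L : Set (ℤ × ℤ)) : Prop :=
  ∃ o u w : ℤ × ℤ, (cross u w = 1 ∨ cross u w = -1) ∧ chart o u w ⁻¹' L = ↑(simplexPoints k)

lemma IsSimplex.ncard (h : IsSimplex k L) : L.ncard = (simplexPoints k).card := by
  obtain ⟨o, u, w, hdet, h⟩ := h
  rw [← ncard_chart_preimage hdet, h, Set.ncard_coe_finset]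

lemma preimage_latticeInterior_simplexPoints :
    chart (1, 1) (1, 0) (0, 1) ⁻¹' latticeInterior ↑(simplexPoints k) = ↑(simplexPoints (k - 3)) := by
  ext ⟨x, y⟩
  rw [Set.mem_preimage, Finset.mem_coe, mem_simplexPoints]
  simp only [chart, mul_one, mul_zero, add_zero]
  refine ⟨fun h => ?_, fun h => ?_⟩
  · have key : ∀ e : ℤ × ℤ, (e.1 ≠ 0 ∨ e.2 ≠ 0) →
        ¬ ∀ q ∈ (↑(simplexPoints k) : Set (ℤ × ℤ)), 0 ≤ cross e (q - (1 + x, 1 + y)) :=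
      fun e he hq => notMem_interior_of_cross_nonneg he hq h
    simp only [Finset.mem_coe, mem_simplexPoints, cross, Prod.fst_sub, Prod.snd_sub] at key
    refine ⟨?_, ?_, ?_⟩
    · by_contra! hx
      exact key (0, -1) (by norm_num) fun q hq => by simp only; linarith
    · by_contra! hy
      exact key (1, 0) (by norm_num) fun q hq => by simp only; linarith
    · by_contra! hxy
      exact key (-1, 1) (by norm_num) fun q hq => by simp only; linarith
  · obtain ⟨hx, hy, hxy⟩ := h
    have hmem : ∀ p : ℤ × ℤ, 0 ≤ p.1 ∧ 0 ≤ p.2 ∧ p.1 + p.2 ≤ k →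
      p ∈ (↑(simplexPoints k) : Set (ℤ × ℤ)) := fun p hp => mem_simplexPoints.2 hp
    refine interior_of_triangle (a := (0, 0)) (b := (k, 0)) (c := (0, k)) (hmem _ ⟨?_, ?_, ?_⟩)
      (hmem _ ⟨?_, ?_, ?_⟩) (hmem _ ⟨?_, ?_, ?_⟩) ?_ (k - 2 - x - y) (1 + x) (1 + y) ?_ ?_ ?_ ?_ ?_ <;>
      try simp only [cross, Prod.fst_sub, Prod.snd_sub]
    all_goals try linarith
    have : 0 < k := by linarith
    nlinarith

lemma IsSimplex.ncard_interior (h : IsSimplex k L) :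
    (latticeInterior L).ncard = (simplexPoints (k - 3)).card := by
  obtain ⟨o, u, w, hdet, h⟩ := h
  rw [← ncard_chart_preimage hdet, ← latticeInterior_chart hdet, h,
    ← ncard_chart_preimage (o := (1, 1)) (u := (1, 0)) (w := (0, 1)) (by simp [cross]),
    preimage_latticeInterior_simplexPoints, Set.ncard_coe_finset]

end Simplex

section Predecessor

variable {L Q : Set (ℤ × ℤ)} {k : ℤ} {a b c p : ℤ × ℤ}

lemma Adj.left_unique (hW : WidthAtLeast Q 1) (h : Adj Q a c) (h' : Adj Q b c) : a = b := by
  have h1 := h.nonneg b h'.left_mem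
  have h2 := h'.nonneg a h.left_mem
  have h0 : cross (c - a) (c - b) = 0 := by
    simp only [cross, Prod.fst_sub, Prod.snd_sub] at *
    linarith
  rcases eq_or_eq_neg_of_cross_eq_zero h.coprime h'.coprime h0 with he | he
  · simpa using he.symm
  · obtain ⟨v, hv, h3⟩ := h.exists_height hW
    have h4 := h'.nonneg v hv
    rw [he] at h4
    obtain ⟨e1, e2⟩ := Prod.ext_iff.1 he
    simp only [cross, Prod.fst_sub, Prod.snd_sub, Prod.fst_neg, Prod.snd_neg] at *
    have h5 : b.1 = 2 * c.1 - a.1 := by linarith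
    have h6 : b.2 = 2 * c.2 - a.2 := by linarith
    rw [h5, h6] at h4
    linarith

lemma LatticeConvex.exists_adj_left (hQ : LatticeConvex Q) (hfin : Q.Finite)
    (hW : WidthAtLeast Q 1) (hp : p ∈ Q) (hpI : p ∉ latticeInterior Q) : ∃ b, Adj Q b p := by
  obtain ⟨nxt, hadj⟩ := exists_next hfin hQ hW
  have : Finite ↥(Q \ latticeInterior Q) := (hfin.subset Set.sdiff_subset).to_subtype
  have hinj : Function.Injective nxt := fun x y hxy =>
    Subtype.ext ((hadj x).left_unique hW (hxy ▸ hadj y))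
  obtain ⟨b, hb⟩ := (Finite.injective_iff_surjective.1 hinj) ⟨p, hp, hpI⟩
  exact ⟨b, by simpa [hb] using hadj b⟩

lemma neg_one_le_of_row (hL : LatticeConvex L) {e q r v : ℤ × ℤ} (he : IsCoprime e.1 e.2)
    (hq : q ∈ latticeInterior L) (hr : r ∈ latticeInterior L) (hqr : r ≠ q)
    (h0 : cross e (r - q) = 0) (hmin : ∀ x ∈ latticeInterior L, 0 ≤ cross e (x - q))
    (hv : v ∈ L) : -1 ≤ cross e (v - q) := by
  obtain ⟨z, g, hg, hz, h1, h2⟩ := exists_isCoprime_mul (sub_ne_zero.2 hqr)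
  have hez : cross e z = 0 := by
    refine (mul_eq_zero.1 (?_ : g * _ = 0)).resolve_left hg.ne'
    rw [← h0]
    simp only [cross, h1, h2]; ring
  have hqz : q + z ∈ latticeInterior L := by
    simp only [Prod.fst_sub, Prod.snd_sub] at h1 h2
    refine (latticeConvex_interior L).combo hq hr hr (g - 1) 1 0 (by linarith) zero_le_one le_rfl
      (by linarith) ?_ ?_
    · rw [Prod.fst_add]; linear_combination -h1
    · rw [Prod.snd_add]; linear_combination -h2
  rcases eq_or_eq_neg_of_cross_eq_zero he hz hez with rfl | rfl
  · have hadj : Adj (latticeInterior L) q (q + z) :=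
      ⟨hq, hqz, by simpa using he, fun x hx => by simpa using hmin x hx⟩
    simpa using hadj.neg_one_le hL hv
  · have hsub : ∀ x : ℤ × ℤ, cross (q - (q + -e)) (x - (q + -e)) = cross e (x - q) := fun x => by
      simp only [cross, Prod.fst_sub, Prod.snd_sub, Prod.fst_add, Prod.snd_add, Prod.fst_neg,
        Prod.snd_neg]
      ring
    have hadj : Adj (latticeInterior L) (q + -e) q :=
      ⟨hqz, hq, by simpa using he, fun x hx => by rw [hsub]; exact hmin x hx⟩
    exact hsub v ▸ hadj.neg_one_le hL hv

end Predecessor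

section WidthOfInterior

variable {L : Set (ℤ × ℤ)} {k m : ℤ}

lemma isSimplex_of_corner (hL : LatticeConvex L) (hW : WidthAtLeast L k) (hk : 0 < k)
    {e₁ e₂ p : ℤ × ℤ} (hdet : cross e₁ e₂ = 1) (h₁ : ∀ v ∈ L, -1 ≤ cross e₁ (v - p))
    (h₂ : ∀ v ∈ L, -1 ≤ cross e₂ (v - p))
    (h₃ : ∀ v ∈ L, cross e₁ (v - p) + cross e₂ (v - p) ≤ k - 2) : IsSimplex k L := by
  have hdet' : cross e₂ (-e₁) = 1 ∨ cross e₂ (-e₁) = -1 := by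
    left
    rw [← hdet]; simp only [cross, Prod.fst_neg, Prod.snd_neg]; ring
  refine ⟨p - e₂ + e₁, e₂, -e₁, hdet', ?_⟩
  set L' := chart (p - e₂ + e₁) e₂ (-e₁) ⁻¹' L with hL'
  have hc₁ : ∀ q, cross e₁ (chart (p - e₂ + e₁) e₂ (-e₁) q - p) = q.1 - 1 := fun q => by
    have : cross e₁ (chart (p - e₂ + e₁) e₂ (-e₁) q - p) = (q.1 - 1) * cross e₁ e₂ := by
      simp only [chart, cross, Prod.fst_sub, Prod.snd_sub, Prod.fst_add, Prod.snd_add,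
        Prod.fst_neg, Prod.snd_neg]
      ring
    rw [this, hdet, mul_one]
  have hc₂ : ∀ q, cross e₂ (chart (p - e₂ + e₁) e₂ (-e₁) q - p) = q.2 - 1 := fun q => by
    have : cross e₂ (chart (p - e₂ + e₁) e₂ (-e₁) q - p) = (q.2 - 1) * cross e₁ e₂ := by
      simp only [chart, cross, Prod.fst_sub, Prod.snd_sub, Prod.fst_add, Prod.snd_add,
        Prod.fst_neg, Prod.snd_neg]
      ring
    rw [this, hdet, mul_one]
  have hx : ∀ q ∈ L', 0 ≤ q.1 := fun q hq => by linarith [h₁ _ hq, hc₁ q]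
  have hy : ∀ q ∈ L', 0 ≤ q.2 := fun q hq => by linarith [h₂ _ hq, hc₂ q]
  have hxy : ∀ q ∈ L', q.1 + q.2 ≤ k := fun q hq => by linarith [h₃ _ hq, hc₁ q, hc₂ q]
  have hW' : WidthAtLeast L' k := hW.chart hdet'
  have hv₀ : (0, 0) ∈ L' := by
    obtain ⟨u, hu, v, hv, huv⟩ := hW' 1 1 (by norm_num)
    have : v = (0, 0) := Prod.ext (by linarith [hx v hv, hy v hv, hxy u hu])
      (by linarith [hx v hv, hy v hv, hxy u hu])
    exact this ▸ hv
  have hv₁ : (k, 0) ∈ L' := by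
    obtain ⟨u, hu, v, hv, huv⟩ := hW' 1 0 (by norm_num)
    have : u = (k, 0) := Prod.ext (by linarith [hx v hv, hy u hu, hxy u hu])
      (by linarith [hx v hv, hy u hu, hxy u hu])
    exact this ▸ hu
  have hv₂ : (0, k) ∈ L' := by
    obtain ⟨u, hu, v, hv, huv⟩ := hW' 0 1 (by norm_num)
    have : u = (0, k) := Prod.ext (by linarith [hy v hv, hx u hu, hxy u hu])
      (by linarith [hy v hv, hx u hu, hxy u hu])
    exact this ▸ hu
  exact Set.Subset.antisymm (fun q hq => mem_simplexPoints.2 ⟨hx q hq, hy q hq, hxy q hq⟩)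
    (hL.chart.simplexPoints_subset hk hv₀ hv₁ hv₂)

lemma isSimplex_of_deep_point (hL : LatticeConvex L) (hfin : (latticeInterior L).Finite)
    (hWL : WidthAtLeast L k) (hW : WidthAtLeast (latticeInterior L) m) (hm : 1 ≤ m)
    (hmk : m + 3 ≤ k) {e p v : ℤ × ℤ} (he : IsCoprime e.1 e.2)
    (hwid : ∀ x ∈ latticeInterior L, ∀ y ∈ latticeInterior L, cross e (x - y) ≤ m)
    (hp : p ∈ latticeInterior L) (hmin : ∀ x ∈ latticeInterior L, 0 ≤ cross e (x - p))
    (hv : v ∈ L) (hvp : cross e (v - p) ≤ -2) : IsSimplex k L := by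
  set Q := latticeInterior L with hQ
  have hW1 := hW.mono hm
  have hunique : ∀ q ∈ Q, cross e (q - p) = 0 → q = p := by
    intro q hq h0
    by_contra hne
    linarith [neg_one_le_of_row hL he hp hq hne h0 hmin hv]
  have he0 : e.1 ≠ 0 ∨ e.2 ≠ 0 := by
    by_contra! hcon
    rw [hcon.1, hcon.2] at he
    exact not_isCoprime_zero_zero he
  have hpI := notMem_interior_of_cross_nonneg he0 hmin
  obtain ⟨c, hc⟩ := (latticeConvex_interior L).exists_adj hfin hW1 hp hpI
  obtain ⟨b, hb⟩ := (latticeConvex_interior L).exists_adj_left hfin hW1 hp hpI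
  obtain ⟨f, hf₁, hf₂⟩ := hb.exists_corner hL hW1 hc
  have hD0 := hb.cross_nonneg hc
  have hs : 0 < cross e (c - p) := by
    refine (hmin c hc.right_mem).lt_of_ne fun h0 => ?_
    have := hc.ne_zero
    rw [hunique c hc.right_mem h0.symm] at this
    simp at this
  have ht : 0 < cross e (b - p) := by
    refine (hmin b hb.left_mem).lt_of_ne fun h0 => ?_
    have := hb.ne_zero
    rw [hunique b hb.left_mem h0.symm] at this
    simp at this
  have hE₁ : ∀ q, cross (p - b) (q - b) = cross (p - b) (q - p) := fun q => by
    simp only [cross, Prod.fst_sub, Prod.snd_sub]; ring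
  have hQ₁ : ∀ q ∈ Q, 0 ≤ cross (p - b) (q - p) := fun q hq => hE₁ q ▸ hb.nonneg q hq
  have hQ₂ : ∀ q ∈ Q, 0 ≤ cross (c - p) (q - p) := hc.nonneg
  have hL₁ : ∀ q ∈ L, -1 ≤ cross (p - b) (q - p) := fun q hq => hE₁ q ▸ hb.neg_one_le hL hq
  have hL₂ : ∀ q ∈ L, -1 ≤ cross (c - p) (q - p) := fun q hq => hc.neg_one_le hL hq
  obtain ⟨q₁, hq₁, hq₁m⟩ := hb.exists_height hW
  rw [hE₁] at hq₁m
  obtain ⟨q₂, hq₂, hq₂m⟩ := hc.exists_height hW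
  have ht' : cross e (p - b) = -cross e (b - p) := by
    simp only [cross, Prod.fst_sub, Prod.snd_sub]; ring
  have hD : 0 < cross (p - b) (c - p) := by
    refine hD0.lt_of_ne fun h0 => ?_
    have := hb.eq_of_cross_eq_zero hW1 hc h0.symm
    rw [this] at ht'
    linarith
  have hq₁p := hwid q₁ hq₁ p hp
  have hq₂p := hwid q₂ hq₂ p hp
  have hq₁₂ := hQ₂ q₁ hq₁
  have hq₂₁ := hQ₁ q₂ hq₂
  have hv₁ := hL₁ v hv
  have hv₂ := hL₂ v hv
  generalize p - b = e₁ at *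
  generalize c - p = e₂ at *
  have key : ∀ w, cross e₁ e₂ * cross e w
      = cross e (b - p) * cross e₂ w + cross e e₂ * cross e₁ w := by
    intro w
    rw [← neg_eq_iff_eq_neg.2 ht']
    simp only [cross]; ring
  have hsD : cross e e₂ ≤ cross e₁ e₂ := by
    have := key (q₁ - p)
    by_contra! hcon
    nlinarith [mul_nonneg ht.le hq₁₂, mul_le_mul_of_nonneg_left hq₁m hs.le,
      mul_le_mul_of_nonneg_left hq₁p hD.le]
  have htD : cross e (b - p) ≤ cross e₁ e₂ := by
    have := key (q₂ - p)
    by_contra! hcon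
    nlinarith [mul_nonneg hs.le hq₂₁, mul_le_mul_of_nonneg_left hq₂m ht.le,
      mul_le_mul_of_nonneg_left hq₂p hD.le]
  have hst : 2 * cross e₁ e₂ ≤ cross e e₂ + cross e (b - p) := by
    have := key (v - p)
    nlinarith [mul_le_mul_of_nonneg_left hv₁ hs.le, mul_le_mul_of_nonneg_left hv₂ ht.le,
      mul_le_mul_of_nonneg_left hvp hD.le]
  have hs' : cross e e₂ = cross e₁ e₂ := by linarith
  have ht'' : cross e (b - p) = cross e₁ e₂ := by linarith
  have hsum : ∀ w, cross e w = cross e₁ w + cross e₂ w := by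
    intro w
    have := key w
    rw [hs', ht''] at this
    exact mul_left_cancel₀ hD.ne' (by linear_combination this)
  have hdiff : ∀ w, cross e₁ e₂ * cross f w = cross e₂ w - cross e₁ w := by
    intro w
    linear_combination cross_mul_cross e₁ e₂ f w + cross e₁ w * (cross_swap e₂ f - hf₂)
      - cross e₂ w * (cross_swap e₁ f - hf₁)
  have hD2 : cross e₁ e₂ ≤ 2 := by
    have hf0 : f.1 ≠ 0 ∨ f.2 ≠ 0 := by
      by_contra! hcon
      simp [cross, hcon.1, hcon.2] at hf₁
    obtain ⟨x, hx, y, hy, hxy⟩ := hW.exists_cross hf0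
    have h1 := hdiff (x - y)
    have h2 : ∀ d, cross d (x - y) = cross d (x - p) - cross d (y - p) := fun d => by
      simp only [cross, Prod.fst_sub, Prod.snd_sub]; ring
    rw [h2 e₁, h2 e₂] at h1
    have h3 := hwid x hx p hp
    have h4 := hwid y hy p hp
    rw [hsum] at h3 h4
    have := hQ₁ x hx
    have := hQ₂ x hx
    have := hQ₁ y hy
    have := hQ₂ y hy
    have h5 := mul_le_mul_of_nonneg_left hxy hD.le
    by_contra! hcon
    nlinarith
  have hD1 : cross e₁ e₂ = 1 := by
    by_contra hne
    have h2 : cross e₁ e₂ = 2 := by omega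
    obtain ⟨g, hg⟩ := exists_cross_eq_one he
    have h3 := hdiff g
    have h4 := hsum g
    rw [h2] at h3
    omega
  have hq₁0 : cross e₁ (q₁ - p) = m ∧ cross e₂ (q₁ - p) = 0 := by
    rw [hsum] at hq₁p
    constructor <;> linarith
  have hq₂0 : cross e₁ (q₂ - p) = 0 ∧ cross e₂ (q₂ - p) = m := by
    rw [hsum] at hq₂p
    constructor <;> linarith
  refine isSimplex_of_corner hL hWL (by linarith) hD1 hL₁ hL₂ fun x hx => ?_
  have hneg : ∀ y, cross (-e) (y - q₁) = m - cross e (y - p) := by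
    intro y
    have h1 := hsum (q₁ - p)
    rw [hq₁0.1, hq₁0.2] at h1
    simp only [cross, Prod.fst_sub, Prod.snd_sub, Prod.fst_neg, Prod.snd_neg] at h1 ⊢
    linarith
  have htop := neg_one_le_of_row hL (e := -e) (by simpa using he.neg_neg) hq₁ hq₂ (by
    rintro rfl
    linarith [hq₁0.1, hq₂0.1]) (by rw [hneg, hsum, hq₂0.1, hq₂0.2]; ring)
    (fun y hy => by rw [hneg]; linarith [hwid y hy p hp]) hx
  rw [hneg, hsum] at htop
  linarith

lemma LatticeConvex.widthAtLeast_interior (hL : LatticeConvex L)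
    (hfin : (latticeInterior L).Finite) (hWL : WidthAtLeast L k)
    (hW : WidthAtLeast (latticeInterior L) 1) (hk : 3 ≤ k) :
    WidthAtLeast (latticeInterior L) (k - 2) ∨ IsSimplex k L := by
  by_contra! hcon
  obtain ⟨hcon, hsimp⟩ := hcon
  obtain ⟨m, hm, hmk, hWm, hnot⟩ : ∃ m, 1 ≤ m ∧ m + 3 ≤ k ∧ WidthAtLeast (latticeInterior L) m ∧
      ¬ WidthAtLeast (latticeInterior L) (m + 1) := by
    by_contra! h
    have : ∀ n : ℕ, (n : ℤ) + 3 ≤ k → WidthAtLeast (latticeInterior L) (n + 1) := by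
      intro n
      induction n with
      | zero => exact fun _ => by simpa using hW
      | succ n ih =>
        intro hn
        push_cast at hn ⊢
        exact h (n + 1) (by omega) (by omega) (ih (by omega))
    refine hcon ?_
    have := this (k - 3).toNat (by omega)
    rwa [Int.toNat_of_nonneg (by omega), show k - 3 + 1 = k - 2 by ring] at this
  unfold WidthAtLeast at hnot
  push Not at hnot
  obtain ⟨A, B, hAB, hwid⟩ := hnot
  have hz : (B, -A) ≠ 0 := by
    intro h
    simp only [Prod.mk_eq_zero, neg_eq_zero] at h
    exact hAB.elim (· h.2) (· h.1)
  obtain ⟨e, g, hg, he, h1, h2⟩ := exists_isCoprime_mul hz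
  simp only at h1 h2
  have hwid' : ∀ x ∈ latticeInterior L, ∀ y ∈ latticeInterior L, cross e (x - y) ≤ m := by
    intro x hx y hy
    have h3 := hwid x hx y hy
    have h4 : A * (x.1 - y.1) + B * (x.2 - y.2) = g * cross e (x - y) := by
      simp only [cross, Prod.fst_sub, Prod.snd_sub]
      linear_combination (x.2 - y.2) * h1 - (x.1 - y.1) * h2
    by_contra! h5
    nlinarith
  have he0 : e.1 ≠ 0 ∨ e.2 ≠ 0 := by
    by_contra! h
    rw [h.1, h.2] at he
    exact not_isCoprime_zero_zero he
  obtain ⟨p, hp, hmin⟩ := hfin.exists_minimalFor (fun x => cross e x) _ hW.nonempty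
  obtain ⟨t, ht, hmax⟩ := hfin.exists_maximalFor (fun x => cross e x) _ hW.nonempty
  have hlin : ∀ x y : ℤ × ℤ, cross e (x - y) = cross e x - cross e y := fun x y => by
    simp only [cross, Prod.fst_sub, Prod.snd_sub]; ring
  have hneg : ∀ x : ℤ × ℤ, cross (-e) x = -cross e x := fun x => by
    simp only [cross, Prod.fst_neg, Prod.snd_neg]; ring
  obtain ⟨u, hu, v, hv, huv⟩ := hWL.exists_cross he0
  by_cases hdown : cross e (v - p) ≤ -2
  · refine hsimp (isSimplex_of_deep_point hL hfin hWL hWm hm hmk he hwid' hp (fun x hx => ?_) hv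
      hdown)
    rw [hlin, sub_nonneg]
    exact (le_total _ _).elim id (hmin hx)
  · refine hsimp (isSimplex_of_deep_point (e := -e) (p := t) (v := u) hL hfin hWL hWm hm hmk
      (by simpa using he.neg_neg) (fun x hx y hy => ?_) ht (fun x hx => ?_) hu ?_)
    · have := hwid' y hy x hx
      rw [hneg]
      rw [hlin] at this ⊢
      linarith
    · rw [hneg, hlin, neg_sub, sub_nonneg]
      exact (le_total _ _).elim id (hmax hx)
    · have := hwid' t ht p hp
      rw [hneg]
      rw [hlin] at this huv hdown ⊢
      linarith

end WidthOfInterior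

section Genus

variable {L : Set (ℤ × ℤ)} {k : ℤ}

lemma LatticeConvex.not_widthAtLeast (hL : LatticeConvex L) (hfin : L.Finite)
    (h7 : 7 ≤ (latticeInterior L).ncard)
    (hk : k = 5 ∧ (latticeInterior L).ncard ≤ 8 ∨ k = 6 ∧ (latticeInterior L).ncard ≤ 9 ∨
      k = 7 ∧ (latticeInterior L).ncard ≤ 12) : ¬ WidthAtLeast L k := by
  intro hW
  have hL₁ := latticeConvex_interior L
  have hfin₁ : (latticeInterior L).Finite := hfin.subset (hL.interior_subset hW.nonempty)
  obtain ⟨a, ha, b, hb, hab⟩ := (Set.one_lt_ncard hfin₁).1 (by omega)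
  have hW₁ : WidthAtLeast (latticeInterior L) (k - 2) := by
    refine (hL.widthAtLeast_interior hfin₁ hW (hL.widthAtLeast_one_interior
      (hW.mono (by omega)) ha hb hab.symm) (by omega)).resolve_right fun h => ?_
    have h0 := h.ncard_interior
    have h2 : (simplexPoints 2).card = 6 := by decide +kernel
    have h4 : (simplexPoints 4).card = 15 := by decide +kernel
    rcases hk with ⟨rfl, h⟩ | ⟨rfl, h⟩ | ⟨rfl, h⟩ <;>
      norm_num [h2, card_simplexPoints_three, h4] at h0 <;> omega
  have hW₁3 := hW₁.mono (show (3 : ℤ) ≤ k - 2 by omega)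
  have hsub := hL₁.interior_subset hW₁.nonempty
  have hfin₂ := hfin₁.subset hsub
  have hL₂ := latticeConvex_interior (latticeInterior L)
  have hcard := Set.ncard_sdiff_add_ncard_of_subset hsub hfin₁
  have h6 := six_le_ncard_boundary hL hfin₁ hW₁3
  obtain ⟨o, ho⟩ := hL₁.interior_nonempty hfin₁ hW₁3
  obtain ⟨c, hc, hco⟩ : ∃ c ∈ latticeInterior (latticeInterior L), c ≠ o := by
    by_contra! hcon
    obtain ⟨h10, h4⟩ := hL₁.ten_le_of_interior_eq_singleton hfin₁ hW₁3
      (Set.eq_singleton_iff_unique_mem.2 ⟨ho, hcon⟩)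
    exact h4 (hW₁.mono (by omega))
  have hW₂ := hL₁.widthAtLeast_one_interior hW₁3 ho hc hco
  have h3 := hW₂.three_le_ncard hfin₂
  have h4 : (simplexPoints 4).card = 15 := by decide +kernel
  have h5 : (simplexPoints 5).card = 21 := by decide +kernel
  rcases hL₁.widthAtLeast_interior hfin₂ hW₁ hW₂ (by omega) with h | h
  · rcases hk with ⟨rfl, hk⟩ | ⟨rfl, hk⟩ | ⟨rfl, hk⟩
    · omega
    · have := hL₂.four_le_ncard hfin₂ h
      omega
    · have hne := (hL₂.interior_nonempty hfin₂ h).ncard_pos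
        (hfin₂.subset (hL₂.interior_subset hW₂.nonempty))
      have hcard₂ := Set.ncard_sdiff_add_ncard_of_subset (hL₂.interior_subset hW₂.nonempty) hfin₂
      have := six_le_ncard_boundary hL₁ hfin₂ h
      omega
  · have := h.ncard
    rcases hk with ⟨rfl, hk⟩ | ⟨rfl, hk⟩ | ⟨rfl, hk⟩
    · omega
    · norm_num [h4] at this
      omega
    · norm_num [h5] at this
      omega

end Genus

section Bridge

variable {S : Set (ℤ × ℤ)} {P : Set (ℝ × ℝ)} {k : ℤ}

lemma linear_apply (f : (ℝ × ℝ) →ₗ[ℝ] ℝ) (x : ℝ × ℝ) :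
    f x = f (1, 0) * x.1 + f (0, 1) * x.2 := by
  have : x = x.1 • (1, 0) + x.2 • (0, 1) := by ext <;> simp
  conv_lhs => rw [this]
  rw [map_add, map_smul, map_smul]
  simp only [smul_eq_mul]; ring

lemma linear_sub_apply (f : (ℝ × ℝ) →ₗ[ℝ] ℝ) (v q : ℤ × ℤ) :
    f (1, 0) * ((v.1 : ℝ) - q.1) + f (0, 1) * ((v.2 : ℝ) - q.2)
      = f (toReal2 v) - f (toReal2 q) := by
  rw [linear_apply f (toReal2 v), linear_apply f (toReal2 q)]
  simp only [toReal2]; ring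

lemma linear_ne_zero {f : (ℝ × ℝ) →ₗ[ℝ] ℝ} (hf : f ≠ 0) : f (1, 0) ≠ 0 ∨ f (0, 1) ≠ 0 := by
  by_contra! hcon
  refine hf (LinearMap.ext fun x => ?_)
  rw [linear_apply, hcon.1, hcon.2]
  simp

lemma latticeConvex_latticePoints (hP : Convex ℝ P) (hcl : IsClosed P) :
    LatticeConvex (latticePoints P) := by
  intro q hq
  by_contra hqP
  obtain ⟨f, u, hfu, huq⟩ := geometric_hahn_banach_closed_point hP hcl hqP
  obtain ⟨v, hv, h⟩ := hq (f (1, 0)) (f (0, 1))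
  have h1 := linear_sub_apply (f : (ℝ × ℝ) →ₗ[ℝ] ℝ) v q
  simp only [ContinuousLinearMap.coe_coe] at h1
  linarith [hfu _ hv]

lemma exists_support_of_notMem_interior (hP : Convex ℝ P) (hne : P.Nonempty) {x : ℝ × ℝ}
    (hx : x ∉ interior P) : ∃ f : (ℝ × ℝ) →ₗ[ℝ] ℝ, f ≠ 0 ∧ ∀ y ∈ P, f y ≤ f x := by
  rcases (interior P).eq_empty_or_nonempty with he | ⟨z, hz⟩
  · have hspan : affineSpan ℝ P ≠ ⊤ := fun h =>
      (hP.interior_nonempty_iff_affineSpan_eq_top.2 h).ne_empty he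
    have hdir : (affineSpan ℝ P).direction < ⊤ := by
      rw [lt_top_iff_ne_top]
      intro h
      exact hspan ((AffineSubspace.direction_eq_top_iff_of_nonempty
        ((affineSpan_nonempty ℝ).2 hne)).1 h)
    obtain ⟨f, hf, hker⟩ := Submodule.exists_le_ker_of_lt_top _ hdir
    obtain ⟨y₀, hy₀⟩ := hne
    have hconst : ∀ y ∈ P, f y = f y₀ := by
      intro y hy
      have := hker (AffineSubspace.vsub_mem_direction (mem_affineSpan ℝ hy) (mem_affineSpan ℝ hy₀))
      rw [LinearMap.mem_ker, vsub_eq_sub, map_sub] at this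
      linarith
    rcases le_total (f y₀) (f x) with h | h
    · exact ⟨f, hf, fun y hy => (hconst y hy).trans_le h⟩
    · refine ⟨-f, neg_ne_zero.2 hf, fun y hy => ?_⟩
      rw [LinearMap.neg_apply, LinearMap.neg_apply, hconst y hy]
      linarith
  · obtain ⟨f, hf⟩ := geometric_hahn_banach_open_point hP.interior isOpen_interior hx
    refine ⟨f, fun h => ?_, fun y hy => ?_⟩
    · have := hf z hz
      have h0 : ∀ y, f y = 0 := fun y => LinearMap.congr_fun h y
      rw [h0, h0] at this
      exact lt_irrefl _ this
    · have hy' : y ∈ closure (interior P) := by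
        rw [hP.closure_interior_eq_closure_of_nonempty_interior ⟨z, hz⟩]
        exact subset_closure hy
      exact closure_minimal (fun w hw => (hf w hw).le)
        (isClosed_le f.continuous continuous_const) hy'

lemma subset_latticePoints_convexHull (S : Set (ℤ × ℤ)) :
    S ⊆ latticePoints (convexHull ℝ (toReal2 '' S)) := fun v hv =>
  subset_convexHull ℝ _ ⟨v, hv, rfl⟩

lemma interiorLatticePoints_convexHull (S : Set (ℤ × ℤ)) :
    interiorLatticePoints (convexHull ℝ (toReal2 '' S))
      = latticeInterior (latticePoints (convexHull ℝ (toReal2 '' S))) := by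
  set P := convexHull ℝ (toReal2 '' S) with hP
  ext q
  refine ⟨fun hq s t hst => ?_, fun hq => ?_⟩
  · by_contra! hcon
    have hhalf : P ⊆ {x | s * (x.1 - q.1) + t * (x.2 - q.2) ≤ 0} := by
      refine convexHull_min ?_ ?_
      · rintro _ ⟨v, hv, rfl⟩
        exact hcon v (subset_latticePoints_convexHull S hv)
      · intro x hx y hy α β hα hβ hαβ
        simp only [Set.mem_ofPred_eq, Prod.fst_add, Prod.snd_add, Prod.smul_fst, Prod.smul_snd,
          smul_eq_mul] at *
        have := add_nonpos (mul_nonpos_of_nonneg_of_nonpos hα hx)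
          (mul_nonpos_of_nonneg_of_nonpos hβ hy)
        refine le_of_eq_of_le ?_ this
        linear_combination (s * q.1 + t * q.2) * hαβ
    have hline : Filter.Tendsto (fun ε : ℝ => toReal2 q + ε • (s, t)) (nhds 0)
        (nhds (toReal2 q)) := by
      have : Continuous fun ε : ℝ => toReal2 q + ε • (s, t) := by fun_prop
      simpa using this.tendsto 0
    have hev := hline.eventually (isOpen_interior.mem_nhds hq)
    obtain ⟨ε, hε, hmem⟩ := ((hev.filter_mono nhdsWithin_le_nhds).and
      (self_mem_nhdsWithin (a := (0 : ℝ)) (s := Set.Ioi 0))).exists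
    have := hhalf (interior_subset hε)
    simp only [toReal2, Set.mem_ofPred_eq, Prod.fst_add, Prod.snd_add, Prod.smul_fst, Prod.smul_snd,
      smul_eq_mul, add_sub_cancel_left] at this
    have hmem : 0 < ε := hmem
    rcases hst with h | h
    · nlinarith [mul_pos hmem (pow_pos (abs_pos.2 h) 2), sq_abs s, mul_nonneg hmem.le (sq_nonneg t)]
    · nlinarith [mul_pos hmem (pow_pos (abs_pos.2 h) 2), sq_abs t, mul_nonneg hmem.le (sq_nonneg s)]
  · by_contra hqP
    obtain ⟨v, hv, -⟩ := hq 1 0 (by norm_num)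
    obtain ⟨f, hf, hle⟩ := exists_support_of_notMem_interior (convex_convexHull ℝ _) ⟨_, hv⟩ hqP
    obtain ⟨w, hw, h⟩ := hq _ _ (linear_ne_zero hf)
    rw [linear_sub_apply] at h
    linarith [hle _ hw]

lemma finite_latticePoints_convexHull (hS : S.Finite) :
    (latticePoints (convexHull ℝ (toReal2 '' S))).Finite := by
  obtain ⟨a, ha⟩ := hS.bddBelow
  obtain ⟨b, hb⟩ := hS.bddAbove
  refine (Set.finite_Icc a b).subset fun p hp => ?_
  have hbox : convexHull ℝ (toReal2 '' S) ⊆ Set.Icc (toReal2 a) (toReal2 b) := by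
    refine convexHull_min ?_ (convex_Icc _ _)
    rintro _ ⟨v, hv, rfl⟩
    have h1 := ha hv
    have h2 := hb hv
    exact ⟨⟨Int.cast_le.2 h1.1, Int.cast_le.2 h1.2⟩, ⟨Int.cast_le.2 h2.1, Int.cast_le.2 h2.2⟩⟩
  obtain ⟨⟨h1, h2⟩, h3, h4⟩ := hbox hp
  exact ⟨⟨Int.cast_le.1 h1, Int.cast_le.1 h2⟩, ⟨Int.cast_le.1 h3, Int.cast_le.1 h4⟩⟩

lemma widthAtLeast_of_le_latticeWidth (hfin : (latticePoints P).Finite)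
    (hne : (latticePoints P).Nonempty) (hk : k ≤ latticeWidth P) :
    WidthAtLeast (latticePoints P) k := by
  intro a b hab
  have hnonneg : ∀ φ, 0 ≤ dirWidth P φ := fun φ =>
    sub_nonneg.2 (csInf_le_csSup (hne.image _) (hfin.image _).bddBelow (hfin.image _).bddAbove)
  have hle : latticeWidth P ≤ dirWidth P (a, b) := by
    refine csInf_le ⟨0, ?_⟩ ⟨(a, b), ?_, rfl⟩
    · rintro _ ⟨φ, -, rfl⟩
      exact hnonneg φ
    · rintro h
      simp only [Prod.mk_eq_zero] at h
      exact hab.elim (· h.1) (· h.2)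
  obtain ⟨u, hu, hu'⟩ := (hne.image fun p : ℤ × ℤ => a * p.1 + b * p.2).csSup_mem (hfin.image _)
  obtain ⟨v, hv, hv'⟩ := (hne.image fun p : ℤ × ℤ => a * p.1 + b * p.2).csInf_mem (hfin.image _)
  refine ⟨u, hu, v, hv, ?_⟩
  simp only [dirWidth] at hle
  rw [← hu', ← hv'] at hle
  linarith

end Bridge

/-- If `P` is a convex lattice polygon (the convex hull of a finite set of
lattice points) with exactly `g` interior lattice points, where `7 ≤ g ≤ 12` and `g ≠ 10`,
then the lattice width of `P` is at most `⌈g/2⌉`. -/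
theorem latticeWidth_le_ceil_half_genus (S : Finset (ℤ × ℤ)) (P : Set (ℝ × ℝ))
    (hP : P = convexHull ℝ (toReal2 '' (S : Set (ℤ × ℤ))))
    (g : ℕ) (hg : (interiorLatticePoints P).ncard = g)
    (hg7 : 7 ≤ g) (hg12 : g ≤ 12) (hg10 : g ≠ 10) :
    latticeWidth P ≤ ⌈(g : ℚ) / 2⌉ := by
  subst hP
  by_contra! hlt
  set P := convexHull ℝ (toReal2 '' (S : Set (ℤ × ℤ))) with hP
  have hfin : (latticePoints P).Finite := finite_latticePoints_convexHull S.finite_toSet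
  have hconv : LatticeConvex (latticePoints P) := latticeConvex_latticePoints
    (convex_convexHull ℝ _) ((S.finite_toSet.image _).isCompact_convexHull ℝ).isClosed
  have hne : (latticePoints P).Nonempty := by
    obtain ⟨q, hq⟩ := Set.nonempty_of_ncard_ne_zero (s := interiorLatticePoints P) (by omega)
    exact ⟨q, interior_subset (s := P) hq⟩
  rw [hP, interiorLatticePoints_convexHull, ← hP] at hg
  have hW := widthAtLeast_of_le_latticeWidth hfin hne (Int.add_one_le_iff.2 hlt)
  refine hconv.not_widthAtLeast hfin (hg ▸ hg7) ?_ hW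
  rw [hg]
  interval_cases g <;> first | exact absurd rfl hg10 | norm_num
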